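/- Let R > 0 and ω = (ω₁,ω₂) ∈ 𝓗² with Θ_R ω = ω. Then there exist ϕ ∈ [0,2π), a global solution u ∈ C¹(ℝ;𝓗²) of the nonlinear Landau–Zener system, and a constant C > 0 such that for all s ≥ 1: ‖u₁(s) − e^{iδF₁(ω)s + iϕ}·e^{iφ(s,GG*)}ω₁‖ ≤ C/s and ‖u₂(s) − e^{iδF₂(ω)s − iϕ}·e^{−iφ(s,G*G)}ω₂‖ ≤ C/s. Moreover, for each fixed ϕ ∈ [0,2π) there is at most one solution u of the system for which both left-hand sides tend to 0 as s → +∞, and if f₁ = f₂ then the conclusion holds with ϕ = 0. -/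

import Mathlib

open ContinuousLinearMap Complex Filter Topology
open scoped InnerProductSpace

noncomputable section

variable {H : Type*} [NormedAddCommGroup H] [InnerProductSpace ℂ H] [CompleteSpace H]

/-- Functional calculus `χ(A)` of a selfadjoint operator `A` for a complex-valued
function `χ : ℝ → ℂ` (defined via the real continuous functional calculus applied to
the real and imaginary parts of `χ`). -/
def fc (χ : ℝ → ℂ) (A : H →L[ℂ] H) : H →L[ℂ] H :=
  cfc (fun x : ℝ => (χ x).re) A + Complex.I • cfc (fun x : ℝ => (χ x).im) A

/-- The commutation assumption: for every continuous `χ : ℝ → ℂ`,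
`χ(GG*)G = Gχ(G*G)` and `χ(G*G)G* = G*χ(GG*)`. -/
def CommHyp (G : H →L[ℂ] H) : Prop :=
  ∀ χ : ℝ → ℂ, Continuous χ →
    (fc χ (G * ContinuousLinearMap.adjoint G)) ∘L G
        = G ∘L (fc χ (ContinuousLinearMap.adjoint G * G)) ∧
    (fc χ (ContinuousLinearMap.adjoint G * G)) ∘L ContinuousLinearMap.adjoint G
        = ContinuousLinearMap.adjoint G ∘L (fc χ (G * ContinuousLinearMap.adjoint G))

/-- The equivalence between `𝓗²` (with its Hilbert space structure) and `𝓗 × 𝓗`. -/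
def eqv : WithLp 2 (H × H) ≃L[ℂ] H × H := WithLp.prodContinuousLinearEquiv 2 ℂ H H

/-- The operator `V(s)(w₁,w₂) = (s·w₁ + Gw₂, G*w₁ − s·w₂)` on `𝓗²`. -/
def Vop (G : H →L[ℂ] H) (s : ℝ) : WithLp 2 (H × H) →L[ℂ] WithLp 2 (H × H) :=
  (eqv (H := H)).symm.toContinuousLinearMap ∘L
    ((((s : ℂ) • ContinuousLinearMap.fst ℂ H H + G ∘L ContinuousLinearMap.snd ℂ H H)).prod
      ((ContinuousLinearMap.adjoint G) ∘L ContinuousLinearMap.fst ℂ H H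
        - (s : ℂ) • ContinuousLinearMap.snd ℂ H H)) ∘L
    (eqv (H := H)).toContinuousLinearMap

/-- `F₁(u) = f₁(‖u₁‖², ‖u₂‖²)`. -/
def F1 (f₁ : ℝ × ℝ → ℝ) (u : WithLp 2 (H × H)) : ℝ := f₁ (‖u.fst‖ ^ 2, ‖u.snd‖ ^ 2)

/-- `F₂(u) = f₂(‖u₁‖², ‖u₂‖²)`. -/
def F2 (f₂ : ℝ × ℝ → ℝ) (u : WithLp 2 (H × H)) : ℝ := f₂ (‖u.fst‖ ^ 2, ‖u.snd‖ ^ 2)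

/-- The nonlinear term `F(u)u = (F₁(u)u₁, F₂(u)u₂)`. -/
def nlt (f₁ f₂ : ℝ × ℝ → ℝ) (u : WithLp 2 (H × H)) : WithLp 2 (H × H) :=
  (WithLp.equiv 2 (H × H)).symm ((F1 f₁ u) • u.fst, (F2 f₂ u) • u.snd)

/-- `u` is a (global, `C¹`) solution of `−i u′(s) = V(s)u(s) + δ F(u(s))u(s)`:
equivalently, `u′(s) = i (V(s)u(s) + δ F(u(s))u(s))` for all `s`. -/
def IsLZSol (G : H →L[ℂ] H) (δ : ℝ) (f₁ f₂ : ℝ × ℝ → ℝ) (u : ℝ → WithLp 2 (H × H)) : Prop :=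
  ∀ s : ℝ, HasDerivAt u (Complex.I • (Vop G s (u s) + δ • nlt f₁ f₂ (u s))) s

/-- `f ∈ C²(ℝ²;ℝ)` with bounded second derivative. -/
def C2Bdd (f : ℝ × ℝ → ℝ) : Prop :=
  ContDiff ℝ 2 f ∧ ∃ C : ℝ, ∀ p : ℝ × ℝ, ‖iteratedFDeriv ℝ 2 f p‖ ≤ C

/-- `θ ∈ C_c^∞(ℝ;ℝ)`, `0 ≤ θ ≤ 1`, `θ = 1` on `(−1/2,1/2)` and `θ = 0` outside `[−1,1]`. -/
def IsCutoff (θ : ℝ → ℝ) : Prop :=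
  ContDiff ℝ (⊤ : ℕ∞) θ ∧ HasCompactSupport θ ∧ (∀ x, 0 ≤ θ x ∧ θ x ≤ 1) ∧
    (∀ x, |x| < 1/2 → θ x = 1) ∧ (∀ x, 1 < |x| → θ x = 0)

/-- The cutoff operator `Θ_R = diag(θ(GG*/R²), θ(G*G/R²))`. -/
def Theta (G : H →L[ℂ] H) (θ : ℝ → ℝ) (R : ℝ) :
    WithLp 2 (H × H) →L[ℂ] WithLp 2 (H × H) :=
  (eqv (H := H)).symm.toContinuousLinearMap ∘L
    ((cfc (fun x : ℝ => θ (x / R ^ 2)) (G * ContinuousLinearMap.adjoint G)).prodMap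
      (cfc (fun x : ℝ => θ (x / R ^ 2)) (ContinuousLinearMap.adjoint G * G))) ∘L
    (eqv (H := H)).toContinuousLinearMap

/-- The phase `φ(s,λ) = s²/2 + (λ/2)·log|s|`. -/
def phase (s lam : ℝ) : ℝ := s ^ 2 / 2 + lam / 2 * Real.log |s|

/-- The unitary operator `e^{iφ(s,GG*)}` on `𝓗`. -/
def ePhaseP (G : H →L[ℂ] H) (s : ℝ) : H →L[ℂ] H :=
  fc (fun lam => Complex.exp (Complex.I * (phase s lam))) (G * ContinuousLinearMap.adjoint G)

/-- The unitary operator `e^{−iφ(s,G*G)}` on `𝓗`. -/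
def ePhaseM (G : H →L[ℂ] H) (s : ℝ) : H →L[ℂ] H :=
  fc (fun lam => Complex.exp (-(Complex.I * (phase s lam))))
    (ContinuousLinearMap.adjoint G * G)

/-- The model asymptotic first component `e^{iδF₁(ω)s + iϕ}·e^{iφ(s,GG*)}ω₁`. -/
def asym1 (G : H →L[ℂ] H) (δ : ℝ) (f₁ : ℝ × ℝ → ℝ) (ω : WithLp 2 (H × H)) (ϕ : ℝ)
    (s : ℝ) : H :=
  Complex.exp (Complex.I * (δ * F1 f₁ ω * s + ϕ)) • (ePhaseP G s ω.fst)

/-- The model asymptotic second component `e^{iδF₂(ω)s − iϕ}·e^{−iφ(s,G*G)}ω₂`. -/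
def asym2 (G : H →L[ℂ] H) (δ : ℝ) (f₂ : ℝ × ℝ → ℝ) (ω : WithLp 2 (H × H)) (ϕ : ℝ)
    (s : ℝ) : H :=
  Complex.exp (Complex.I * (δ * F2 f₂ ω * s - ϕ)) • (ePhaseM G s ω.snd)

/-- `α` is the incoming scattering state (at `s → −∞`) of `u`, with phase shift `ϕ`. -/
def Incoming (G : H →L[ℂ] H) (δ : ℝ) (f₁ f₂ : ℝ × ℝ → ℝ) (α : WithLp 2 (H × H)) (ϕ : ℝ)
    (u : ℝ → WithLp 2 (H × H)) : Prop :=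
  Tendsto (fun s => ‖(u s).fst - asym1 G δ f₁ α ϕ s‖ + ‖(u s).snd - asym2 G δ f₂ α ϕ s‖)
    atBot (𝓝 0)

/-- `ω` is the outgoing scattering state (at `s → +∞`) of `u`, with phase shift `ϕ`. -/
def Outgoing (G : H →L[ℂ] H) (δ : ℝ) (f₁ f₂ : ℝ × ℝ → ℝ) (ω : WithLp 2 (H × H)) (ϕ : ℝ)
    (u : ℝ → WithLp 2 (H × H)) : Prop :=
  Tendsto (fun s => ‖(u s).fst - asym1 G δ f₁ ω ϕ s‖ + ‖(u s).snd - asym2 G δ f₂ ω ϕ s‖)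
    atTop (𝓝 0)

/-- `M(u) = (δ/2)(F₁(u) + F₂(u))`. -/
def Mscal (δ : ℝ) (f₁ f₂ : ℝ × ℝ → ℝ) (u : WithLp 2 (H × H)) : ℝ :=
  δ / 2 * (F1 f₁ u + F2 f₂ u)

/-- `m(u) = (δ/2)(F₁(u) − F₂(u))`. -/
def mscal (δ : ℝ) (f₁ f₂ : ℝ × ℝ → ℝ) (u : WithLp 2 (H × H)) : ℝ :=
  δ / 2 * (F1 f₁ u - F2 f₂ u)

/-- The gauge transform `v(s) = e^{−i∫₀ˢ M(u(τ))dτ}·u(s)`. -/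
def gaugeT (δ : ℝ) (f₁ f₂ : ℝ × ℝ → ℝ) (u : ℝ → WithLp 2 (H × H)) :
    ℝ → WithLp 2 (H × H) :=
  fun s => Complex.exp (-(Complex.I * (∫ τ in (0:ℝ)..s, Mscal δ f₁ f₂ (u τ)))) • u s

/-- `σ(s) = s + m(u(s))`. -/
def sigma (δ : ℝ) (f₁ f₂ : ℝ × ℝ → ℝ) (u : ℝ → WithLp 2 (H × H)) (s : ℝ) : ℝ :=
  s + mscal δ f₁ f₂ (u s)

/-- The operator `Λ_t = diag((t² + GG*)^{1/2}, (t² + G*G)^{1/2})` on `𝓗²`. -/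
def LamOp (G : H →L[ℂ] H) (t : ℝ) : WithLp 2 (H × H) →L[ℂ] WithLp 2 (H × H) :=
  (eqv (H := H)).symm.toContinuousLinearMap ∘L
    ((cfc (fun x : ℝ => Real.sqrt (t ^ 2 + x)) (G * ContinuousLinearMap.adjoint G)).prodMap
      (cfc (fun x : ℝ => Real.sqrt (t ^ 2 + x)) (ContinuousLinearMap.adjoint G * G))) ∘L
    (eqv (H := H)).toContinuousLinearMap

/-- The operator `Λ_t⁻¹ = diag((t² + GG*)^{-1/2}, (t² + G*G)^{-1/2})` on `𝓗²`. -/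
def LamInv (G : H →L[ℂ] H) (t : ℝ) : WithLp 2 (H × H) →L[ℂ] WithLp 2 (H × H) :=
  (eqv (H := H)).symm.toContinuousLinearMap ∘L
    ((cfc (fun x : ℝ => (Real.sqrt (t ^ 2 + x))⁻¹)
        (G * ContinuousLinearMap.adjoint G)).prodMap
      (cfc (fun x : ℝ => (Real.sqrt (t ^ 2 + x))⁻¹)
        (ContinuousLinearMap.adjoint G * G))) ∘L
    (eqv (H := H)).toContinuousLinearMap

/-- The projection `Π_t^+ = (1/2)(Id + Λ_t⁻¹V(t))`. -/
def PiP (G : H →L[ℂ] H) (t : ℝ) : WithLp 2 (H × H) →L[ℂ] WithLp 2 (H × H) :=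
  (2 : ℂ)⁻¹ • (1 + LamInv G t ∘L Vop G t)

/-- The projection `Π_t^- = (1/2)(Id − Λ_t⁻¹V(t))`. -/
def PiM (G : H →L[ℂ] H) (t : ℝ) : WithLp 2 (H × H) →L[ℂ] WithLp 2 (H × H) :=
  (2 : ℂ)⁻¹ • (1 - LamInv G t ∘L Vop G t)

/-- `m̃(x,y) = (δ/2)(f₁(x,y) − f₂(x,y))`. -/
def mtilde (δ : ℝ) (f₁ f₂ : ℝ × ℝ → ℝ) : ℝ × ℝ → ℝ := fun p => δ / 2 * (f₁ p - f₂ p)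

/-- `m̲(s) = (∂₁m̃ − ∂₂m̃)(‖v₁(s)‖², ‖v₂(s)‖²)`. -/
def mbar (δ : ℝ) (f₁ f₂ : ℝ × ℝ → ℝ) (v : ℝ → WithLp 2 (H × H)) (s : ℝ) : ℝ :=
  fderiv ℝ (mtilde δ f₁ f₂) (‖(v s).fst‖ ^ 2, ‖(v s).snd‖ ^ 2) (1, 0) -
    fderiv ℝ (mtilde δ f₁ f₂) (‖(v s).fst‖ ^ 2, ‖(v s).snd‖ ^ 2) (0, 1)


/-- The operator `A(a,b,c,d)(w₁,w₂) = (a(GG*)w₁ + b(GG*)Gw₂, c(G*G)G*w₁ + d(G*G)w₂)`. -/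
def Aop (G : H →L[ℂ] H) (a b c d : ℝ → ℂ) :
    WithLp 2 (H × H) →L[ℂ] WithLp 2 (H × H) :=
  (eqv (H := H)).symm.toContinuousLinearMap ∘L
    (((fc a (G * ContinuousLinearMap.adjoint G)) ∘L ContinuousLinearMap.fst ℂ H H
        + (fc b (G * ContinuousLinearMap.adjoint G)) ∘L G ∘L ContinuousLinearMap.snd ℂ H H).prod
      ((fc c (ContinuousLinearMap.adjoint G * G)) ∘L (ContinuousLinearMap.adjoint G)
          ∘L ContinuousLinearMap.fst ℂ H H
        + (fc d (ContinuousLinearMap.adjoint G * G)) ∘L ContinuousLinearMap.snd ℂ H H)) ∘L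
    (eqv (H := H)).toContinuousLinearMap

/-- The operator `𝒦(w₁,w₂) = (−Gw₂, G*w₁)` on `𝓗²`. -/
def Kcal (G : H →L[ℂ] H) : WithLp 2 (H × H) →L[ℂ] WithLp 2 (H × H) :=
  (eqv (H := H)).symm.toContinuousLinearMap ∘L
    ((-(G ∘L ContinuousLinearMap.snd ℂ H H)).prod
      ((ContinuousLinearMap.adjoint G) ∘L ContinuousLinearMap.fst ℂ H H)) ∘L
    (eqv (H := H)).toContinuousLinearMap

section ODE

variable {E : Type*} [NormedAddCommGroup E] [InnerProductSpace ℂ E]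

/-- Along a vector field orthogonal to the position, the norm is conserved. -/
theorem norm_eq_of_hasDerivAt_orthogonal {s : Set ℝ} (hs : IsOpen s) (hs' : IsPreconnected s)
    {v : ℝ → E → E} (hv : ∀ t x, (⟪x, v t x⟫_ℂ).re = 0) {u : ℝ → E}
    (hu : ∀ t ∈ s, HasDerivAt u (v t (u t)) t) {a b : ℝ} (ha : a ∈ s) (hb : b ∈ s) :
    ‖u a‖ = ‖u b‖ := by
  have hd : ∀ t ∈ s, HasDerivAt (fun t => ⟪u t, u t⟫_ℂ)
      (⟪u t, v t (u t)⟫_ℂ + ⟪v t (u t), u t⟫_ℂ) t := fun t ht =>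
    (hu t ht).inner ℂ (hu t ht)
  have h0 : ∀ t ∈ s, HasDerivAt (fun t => ⟪u t, u t⟫_ℂ) 0 t := by
    intro t ht
    convert hd t ht using 1
    rw [← inner_conj_symm (v t (u t)) (u t), Complex.add_conj, hv]
    simp
  have := hs.is_const_of_deriv_eq_zero hs' (f := fun t => ⟪u t, u t⟫_ℂ)
    (fun t ht => (h0 t ht).differentiableAt.differentiableWithinAt)
    (fun t ht => (h0 t ht).deriv) ha hb
  simp only [inner_self_eq_norm_sq_to_K] at this
  have h2 : ‖u a‖ ^ 2 = ‖u b‖ ^ 2 := by exact_mod_cast this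
  exact (sq_eq_sq₀ (norm_nonneg _) (norm_nonneg _)).1 h2

variable [FiniteDimensional ℂ E]

/-- A jointly `C¹` time-dependent field is Lipschitz in space, uniformly on compact sets. -/
theorem exists_lipschitzOnWith_of_contDiff {v : ℝ → E → E}
    (hv : ContDiff ℝ 1 (fun p : ℝ × E => v p.1 p.2)) (a b r : ℝ) (x₀ : E) :
    ∃ K : NNReal, ∀ t ∈ Set.Icc a b, LipschitzOnWith K (v t) (Metric.closedBall x₀ r) := by
  have : FiniteDimensional ℝ E := FiniteDimensional.complexToReal E
  have : ProperSpace E := FiniteDimensional.proper ℝ E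
  obtain ⟨K, hK⟩ := LocallyLipschitzOn.exists_lipschitzOnWith_of_compact
    (s := Set.Icc a b ×ˢ Metric.closedBall x₀ r)
    (isCompact_Icc.prod (isCompact_closedBall x₀ r)) (hv.locallyLipschitz.locallyLipschitzOn)
  refine ⟨K, fun t ht x hx y hy => ?_⟩
  have := hK (Set.mk_mem_prod ht hx) (Set.mk_mem_prod ht hy)
  simpa [Prod.edist_eq] using this

theorem eq_of_hasDerivAt_of_contDiff {v : ℝ → E → E}
    (hv : ContDiff ℝ 1 (fun p : ℝ × E => v p.1 p.2)) {a b t₀ : ℝ} (ht₀ : t₀ ∈ Set.Ioo a b)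
    {u u' : ℝ → E} {r : ℝ}
    (hu : ∀ t ∈ Set.Ioo a b, HasDerivAt u (v t (u t)) t ∧ ‖u t‖ ≤ r)
    (hu' : ∀ t ∈ Set.Ioo a b, HasDerivAt u' (v t (u' t)) t ∧ ‖u' t‖ ≤ r)
    (h : u t₀ = u' t₀) : Set.EqOn u u' (Set.Ioo a b) := by
  obtain ⟨K, hK⟩ := exists_lipschitzOnWith_of_contDiff hv a b r 0
  exact ODE_solution_unique_of_mem_Ioo (s := fun _ => Metric.closedBall 0 r)
    (fun t ht => hK t (Set.Ioo_subset_Icc_self ht)) ht₀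
    (fun t ht => ⟨(hu t ht).1, by simpa using (hu t ht).2⟩)
    (fun t ht => ⟨(hu' t ht).1, by simpa using (hu' t ht).2⟩) h

/-- Solutions on bounded time intervals for norm-preserving `C¹` fields. -/
theorem exists_hasDerivAt_Ioo_of_orthogonal {v : ℝ → E → E}
    (hv : ContDiff ℝ 1 (fun p : ℝ × E => v p.1 p.2))
    (horth : ∀ t x, (⟪x, v t x⟫_ℂ).re = 0) (t₀ : ℝ) (x₀ : E) (T : ℝ) (hT : 0 < T) :
    ∃ u : ℝ → E, u t₀ = x₀ ∧ ∀ t ∈ Set.Ioo (t₀ - T) (t₀ + T),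
      HasDerivAt u (v t (u t)) t ∧ ‖u t‖ = ‖x₀‖ := by
  have : FiniteDimensional ℝ E := FiniteDimensional.complexToReal E
  have : ProperSpace E := FiniteDimensional.proper ℝ E
  have : CompleteSpace E := FiniteDimensional.complete ℝ E
  set χ : E → ℝ := fun x => Real.smoothTransition (2 + ‖x₀‖ ^ 2 - ‖x‖ ^ 2) with hχ
  have hχ0 : ∀ x, 0 ≤ χ x := fun x => Real.smoothTransition.nonneg _
  have hχ1 : ∀ x, χ x ≤ 1 := fun x => Real.smoothTransition.le_one _
  set X : ℝ → E → E := fun t x => χ x • v t x with hX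
  have hnsq : ContDiff ℝ 1 (fun x : E => ‖x‖ ^ 2) := contDiff_norm_sq ℂ
  have hXs : ContDiff ℝ 1 (fun p : ℝ × E => X p.1 p.2) := by
    have h1 : ContDiff ℝ 1 (fun p : ℝ × E => 2 + ‖x₀‖ ^ 2 - ‖p.2‖ ^ 2) :=
      contDiff_const.sub (hnsq.comp contDiff_snd)
    have h2 : ContDiff ℝ 1 (fun p : ℝ × E => χ p.2) :=
      (Real.smoothTransition.contDiff (n := 1)).comp h1
    exact h2.smul hv
  have hXo : ∀ t x, (⟪x, X t x⟫_ℂ).re = 0 := by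
    intro t x
    have : X t x = ((χ x : ℝ) : ℂ) • v t x := by simp [hX]
    rw [this, inner_smul_right, Complex.re_ofReal_mul, horth, mul_zero]
  obtain ⟨L, hL⟩ : ∃ L : ℝ, ∀ p ∈ Set.Icc (t₀ - T) (t₀ + T) ×ˢ
      Metric.closedBall (0 : E) (Real.sqrt (2 + ‖x₀‖ ^ 2)), ‖v p.1 p.2‖ ≤ L :=
    (isCompact_Icc.prod (isCompact_closedBall _ _)).exists_bound_of_continuousOn
      hv.continuous.continuousOn
  have hXb : ∀ t ∈ Set.Icc (t₀ - T) (t₀ + T), ∀ x, ‖X t x‖ ≤ max L 0 := by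
    intro t ht x
    by_cases hx : ‖x‖ ≤ Real.sqrt (2 + ‖x₀‖ ^ 2)
    · have h1 := hL (t, x) ⟨ht, by simpa using hx⟩
      calc ‖X t x‖ = χ x * ‖v t x‖ := by rw [hX]; simp [norm_smul, abs_of_nonneg (hχ0 x)]
        _ ≤ 1 * ‖v t x‖ := by gcongr; exact hχ1 x
        _ ≤ max L 0 := by rw [one_mul]; exact h1.trans (le_max_left _ _)
    · have h2 : χ x = 0 := by
        apply Real.smoothTransition.zero_of_nonpos
        rw [not_le, Real.sqrt_lt (by positivity) (norm_nonneg _)] at hx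
        linarith
      simp [hX, h2]
  set L' : NNReal := ⟨max L 0, le_max_right _ _⟩
  obtain ⟨K, hK⟩ := exists_lipschitzOnWith_of_contDiff hXs (t₀ - T) (t₀ + T)
    ((L' : ℝ) * T) x₀
  have hPL : IsPicardLindelof X (tmin := t₀ - T) (tmax := t₀ + T)
      ⟨t₀, by constructor <;> linarith⟩ x₀ (L' * ⟨T, hT.le⟩) 0 L' K := by
    refine ⟨fun t ht => hK t ht, fun x _ => ?_, fun t ht x _ => hXb t ht x, ?_⟩
    · exact (hXs.continuous.comp (Continuous.prodMk continuous_id continuous_const)).continuousOn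
    · simp only [add_sub_cancel_left, sub_sub_cancel, max_self, NNReal.coe_zero, sub_zero]
      exact le_rfl
  obtain ⟨u, hu0, hu⟩ := hPL.exists_eq_forall_mem_Icc_hasDerivWithinAt₀
  simp only at hu0
  have hu' : ∀ t ∈ Set.Ioo (t₀ - T) (t₀ + T), HasDerivAt u (X t (u t)) t := fun t ht =>
    (hu t (Set.Ioo_subset_Icc_self ht)).hasDerivAt (Icc_mem_nhds ht.1 ht.2)
  have hn : ∀ t ∈ Set.Ioo (t₀ - T) (t₀ + T), ‖u t‖ = ‖x₀‖ := by
    intro t ht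
    rw [norm_eq_of_hasDerivAt_orthogonal isOpen_Ioo isPreconnected_Ioo hXo hu' ht
      (b := t₀) ⟨by linarith, by linarith⟩, hu0]
  refine ⟨u, hu0, fun t ht => ⟨?_, hn t ht⟩⟩
  have : χ (u t) = 1 := by
    apply Real.smoothTransition.one_of_one_le
    rw [hn t ht]; linarith
  simpa [hX, this] using hu' t ht

/-- Global existence for norm-preserving `C¹` fields. -/
theorem exists_forall_hasDerivAt_of_orthogonal {v : ℝ → E → E}
    (hv : ContDiff ℝ 1 (fun p : ℝ × E => v p.1 p.2))
    (horth : ∀ t x, (⟪x, v t x⟫_ℂ).re = 0) (t₀ : ℝ) (x₀ : E) :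
    ∃ u : ℝ → E, u t₀ = x₀ ∧ ∀ t, HasDerivAt u (v t (u t)) t := by
  choose U hU0 hU using fun n : ℕ =>
    exists_hasDerivAt_Ioo_of_orthogonal hv horth t₀ x₀ (n + 1) (by positivity)
  have hagree : ∀ n m : ℕ, n ≤ m → Set.EqOn (U n) (U m)
      (Set.Ioo (t₀ - (n + 1)) (t₀ + (n + 1))) := by
    intro n m hnm
    have hnm' : (n : ℝ) ≤ m := by exact_mod_cast hnm
    refine eq_of_hasDerivAt_of_contDiff hv (t₀ := t₀) (r := ‖x₀‖)
      ⟨by linarith [n.cast_nonneg (α := ℝ)], by linarith [n.cast_nonneg (α := ℝ)]⟩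
      (fun t ht => ⟨(hU n t ht).1, (hU n t ht).2.le⟩) (fun t ht => ?_)
      (by rw [hU0, hU0])
    have := hU m t ⟨by linarith [ht.1], by linarith [ht.2]⟩
    exact ⟨this.1, this.2.le⟩
  set N : ℝ → ℕ := fun t => ⌈|t - t₀|⌉₊
  have hN : ∀ t (n : ℕ), |t - t₀| < n + 1 → U (N t) t = U n t := by
    intro t n ht
    have h1 : |t - t₀| < N t + 1 := (Nat.le_ceil _).trans_lt (lt_add_one _)
    have hmem : ∀ k : ℕ, |t - t₀| < k + 1 → t ∈ Set.Ioo (t₀ - (k + 1)) (t₀ + (k + 1)) := by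
      intro k hk
      rw [abs_lt] at hk
      constructor <;> linarith [hk.1, hk.2]
    rcases le_total (N t) n with h | h
    · exact hagree _ _ h (hmem _ h1)
    · exact (hagree _ _ h (hmem _ ht)).symm
  refine ⟨fun t => U (N t) t, by simpa using hU0 (N t₀), fun t => ?_⟩
  have h1 : |t - t₀| < N t + 1 := (Nat.le_ceil _).trans_lt (lt_add_one _)
  have hd := (hU (N t) t (by rw [abs_lt] at h1; constructor <;> linarith [h1.1, h1.2])).1
  refine hd.congr_of_eventuallyEq ?_
  have hopen : IsOpen {τ : ℝ | |τ - t₀| < N t + 1} := isOpen_lt (by fun_prop) (by fun_prop)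
  filter_upwards [hopen.mem_nhds h1] with τ hτ using hN τ (N t) hτ

/-- Continuous dependence on the datum at the left end of an interval. -/
theorem exists_dist_le_of_hasDerivAt {v : ℝ → E → E}
    (hv : ContDiff ℝ 1 (fun p : ℝ × E => v p.1 p.2)) (a b r : ℝ) :
    ∃ M : ℝ, ∀ u u' : ℝ → E, (∀ t, HasDerivAt u (v t (u t)) t) →
      (∀ t, HasDerivAt u' (v t (u' t)) t) → (∀ t, ‖u t‖ ≤ r) → (∀ t, ‖u' t‖ ≤ r) →
      ∀ t ∈ Set.Icc a b, ‖u t - u' t‖ ≤ M * ‖u a - u' a‖ := by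
  obtain ⟨K, hK⟩ := exists_lipschitzOnWith_of_contDiff hv a b r 0
  refine ⟨Real.exp (K * (b - a)), fun u u' hu hu' hr hr' t ht => ?_⟩
  have := dist_le_of_trajectories_ODE_of_mem (v := v) (f := u) (g := u') (K := K)
    (s := fun _ => Metric.closedBall 0 r) (a := a) (b := b) (δ := ‖u a - u' a‖)
    (fun t ht => hK t (Set.Ico_subset_Icc_self ht))
    (fun t _ => (hu t).continuousAt.continuousWithinAt)
    (fun t _ => (hu t).hasDerivWithinAt) (fun t _ => by simpa using hr t)
    (fun t _ => (hu' t).continuousAt.continuousWithinAt)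
    (fun t _ => (hu' t).hasDerivWithinAt) (fun t _ => by simpa using hr' t)
    (by rw [dist_eq_norm]) t ht
  rw [dist_eq_norm] at this
  refine this.trans ?_
  rw [mul_comm]
  gcongr
  exact ht.2

end ODE

section Scalar

variable {K : Type*} [NormedAddCommGroup K] [InnerProductSpace ℂ K] [CompleteSpace K]

/-- The nonlinear Landau–Zener system in components, when the nonlinearities depend only on the
squared norm of the first component and the total squared norm is `E`. -/
structure IsLZPair (G : K →L[ℂ] K) (k₁ k₂ : ℝ → ℝ) (E : ℝ) (x y : ℝ → K) : Prop where
  deriv_fst : ∀ s, HasDerivAt x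
    (I • (((s + k₁ (‖x s‖ ^ 2) : ℝ) : ℂ) • x s + G (y s))) s
  deriv_snd : ∀ s, HasDerivAt y
    (I • (adjoint G (x s) + ((-s + k₂ (‖x s‖ ^ 2) : ℝ) : ℂ) • y s)) s
  normSq_add : ∀ s, ‖x s‖ ^ 2 + ‖y s‖ ^ 2 = E

/-- Half the difference of the two scalar nonlinearities. -/
def halfDiff (k₁ k₂ : ℝ → ℝ) (a : ℝ) : ℝ := (k₁ a - k₂ a) / 2

/-- The energy `s (‖x‖² - n) + Φ(‖x‖²) + Re ⟪x, G y⟫`. -/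
def lzEnergy (G : K →L[ℂ] K) (Φ : ℝ → ℝ) (n : ℝ) (x y : ℝ → K) (s : ℝ) : ℝ :=
  s * (‖x s‖ ^ 2 - n) + Φ (‖x s‖ ^ 2) + (⟪x s, G (y s)⟫_ℂ).re

/-- The real part of the energy flux `‖G* x‖² - ‖G y‖²`. -/
def lzFlux (G : K →L[ℂ] K) (x y : K) : ℝ := ‖adjoint G x‖ ^ 2 - ‖G y‖ ^ 2

namespace IsLZPair

variable {G : K →L[ℂ] K} {k₁ k₂ : ℝ → ℝ} {E : ℝ} {x y : ℝ → K}

theorem hasDerivAt_normSq (h : IsLZPair G k₁ k₂ E x y) (s : ℝ) :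
    HasDerivAt (fun s => ‖x s‖ ^ 2) (-2 * (⟪x s, G (y s)⟫_ℂ).im) s := by
  have h1 := (h.deriv_fst s).inner ℂ (h.deriv_fst s)
  have h2 := Complex.reCLM.hasFDerivAt.comp_hasDerivAt s h1
  have e : (Complex.reCLM ∘ fun t => ⟪x t, x t⟫_ℂ) = fun s => ‖x s‖ ^ 2 := by
    funext t
    simp only [Function.comp, Complex.reCLM_apply, inner_self_eq_norm_sq_to_K]
    norm_cast
  rw [e] at h2
  refine HasDerivAt.congr_deriv (h2) ?_
  simp only [Complex.reCLM_apply, Complex.add_re, inner_smul_left, inner_smul_right,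
    inner_add_left, inner_add_right, inner_self_eq_norm_sq_to_K]
  have hc : (⟪G (y s), x s⟫_ℂ).im = -(⟪x s, G (y s)⟫_ℂ).im := by
    rw [← inner_conj_symm (G (y s)) (x s), Complex.conj_im]
  simp [← Complex.ofReal_pow]
  linear_combination hc

theorem hasDerivAt_inner (h : IsLZPair G k₁ k₂ E x y) (s : ℝ) :
    HasDerivAt (fun s => ⟪x s, G (y s)⟫_ℂ)
      (-(2 * I * ((s + halfDiff k₁ k₂ (‖x s‖ ^ 2) : ℝ) : ℂ)) * ⟪x s, G (y s)⟫_ℂ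
        + I * (lzFlux G (x s) (y s) : ℂ)) s := by
  have hG : HasDerivAt (fun s => G (y s)) _ s :=
    (G.restrictScalars ℝ).hasFDerivAt.comp_hasDerivAt s (h.deriv_snd s)
  have h1 := (h.deriv_fst s).inner ℂ hG
  refine HasDerivAt.congr_deriv (h1) ?_
  simp only [ContinuousLinearMap.coe_restrictScalars', map_smul, map_add,
    inner_smul_left, inner_smul_right, inner_add_left, inner_add_right, inner_self_eq_norm_sq_to_K]
  rw [← adjoint_inner_left G, ← adjoint_inner_left G]
  simp only [inner_self_eq_norm_sq_to_K, halfDiff, lzFlux]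
  simp
  ring

theorem hasDerivAt_re (h : IsLZPair G k₁ k₂ E x y) (s : ℝ) :
    HasDerivAt (fun s => (⟪x s, G (y s)⟫_ℂ).re)
      (2 * (s + halfDiff k₁ k₂ (‖x s‖ ^ 2)) * (⟪x s, G (y s)⟫_ℂ).im) s := by
  refine HasDerivAt.congr_deriv (Complex.reCLM.hasFDerivAt.comp_hasDerivAt s (h.hasDerivAt_inner s)) ?_
  simp

theorem hasDerivAt_im (h : IsLZPair G k₁ k₂ E x y) (s : ℝ) :
    HasDerivAt (fun s => (⟪x s, G (y s)⟫_ℂ).im)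
      (-(2 * (s + halfDiff k₁ k₂ (‖x s‖ ^ 2)) * (⟪x s, G (y s)⟫_ℂ).re)
        + lzFlux G (x s) (y s)) s := by
  refine HasDerivAt.congr_deriv (Complex.imCLM.hasFDerivAt.comp_hasDerivAt s (h.hasDerivAt_inner s)) ?_
  simp

variable {Φ : ℝ → ℝ} (n : ℝ)

theorem hasDerivAt_lzEnergy (h : IsLZPair G k₁ k₂ E x y)
    (hΦ : ∀ a, HasDerivAt Φ (halfDiff k₁ k₂ a) a) (s : ℝ) :
    HasDerivAt (lzEnergy G Φ n x y) (‖x s‖ ^ 2 - n) s := by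
  have h1 := ((hasDerivAt_id s).mul ((h.hasDerivAt_normSq s).sub_const n)).add
    ((hΦ (‖x s‖ ^ 2)).comp s (h.hasDerivAt_normSq s)) |>.add (h.hasDerivAt_re s)
  refine HasDerivAt.congr_deriv (h1) ?_
  simp
  ring

theorem hasDerivAt_lzEnergy_div (h : IsLZPair G k₁ k₂ E x y)
    (hΦ : ∀ a, HasDerivAt Φ (halfDiff k₁ k₂ a) a) {s : ℝ} (hs : s ≠ 0) :
    HasDerivAt (fun s => lzEnergy G Φ n x y s / s)
      (-((Φ (‖x s‖ ^ 2) + (⟪x s, G (y s)⟫_ℂ).re) / s ^ 2)) s := by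
  refine HasDerivAt.congr_deriv ((h.hasDerivAt_lzEnergy n hΦ s).div (hasDerivAt_id s) hs) ?_
  simp only [lzEnergy]
  field_simp
  ring

theorem hasDerivAt_lzEnergy_div_sub (h : IsLZPair G k₁ k₂ E x y)
    (hΦ : ∀ a, HasDerivAt Φ (halfDiff k₁ k₂ a) a) {s : ℝ} (hs : s ≠ 0) :
    HasDerivAt (fun s => lzEnergy G Φ n x y s / s - (⟪x s, G (y s)⟫_ℂ).im / (2 * s ^ 3))
      (-(Φ (‖x s‖ ^ 2) / s ^ 2)
        + (halfDiff k₁ k₂ (‖x s‖ ^ 2) * (⟪x s, G (y s)⟫_ℂ).re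
          - lzFlux G (x s) (y s) / 2) / s ^ 3
        + (3 / 2 * (⟪x s, G (y s)⟫_ℂ).im) / s ^ 4) s := by
  have h3 : HasDerivAt (fun s : ℝ => 2 * s ^ 3) (2 * (3 * s ^ 2)) s := by
    simpa using (hasDerivAt_pow 3 s).const_mul 2
  refine HasDerivAt.congr_deriv ((h.hasDerivAt_lzEnergy_div n hΦ hs).sub
    ((h.hasDerivAt_im s).div h3 (by positivity))) ?_
  field_simp
  ring

end IsLZPair

end Scalar

section Decay

variable {ι : Type*} {F F' : Type*} [NormedAddCommGroup F] [NormedAddCommGroup F']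

/-- `f (i, s)` is bounded by a constant multiple of `D i / s ^ k` on `S`. -/
def Dec (S : Set (ι × ℝ)) (D : ι → ℝ) (k : ℕ) (f : ι × ℝ → F) : Prop :=
  ∃ C, 0 ≤ C ∧ ∀ p ∈ S, ‖f p‖ ≤ C * (D p.1 / p.2 ^ k)

/-- The standing assumptions on an index set and a weight for decay estimates. -/
structure IsDecDomain (S : Set (ι × ℝ)) (D : ι → ℝ) : Prop where
  one_le : ∀ p ∈ S, 1 ≤ p.2
  nonneg : ∀ p ∈ S, 0 ≤ D p.1

/-- From every point of `S` one can follow the `s`-direction inside `S` up to a point where `h` is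
bounded by `C D / s ^ k`, up to an arbitrarily small error. -/
def ControlledAtEnd (S : Set (ι × ℝ)) (D : ι → ℝ) (k : ℕ) (h : ι × ℝ → F) : Prop :=
  ∃ C, 0 ≤ C ∧ ∀ p ∈ S, ∀ η > 0, ∃ t, p.2 ≤ t ∧ (∀ τ ∈ Set.Icc p.2 t, (p.1, τ) ∈ S) ∧
    ‖h (p.1, t)‖ ≤ C * (D p.1 / p.2 ^ k) + η

variable {S : Set (ι × ℝ)} {D : ι → ℝ} {j k : ℕ} {f g : ι × ℝ → F}

theorem IsDecDomain.one (hS : IsDecDomain S D) : IsDecDomain S fun _ => 1 :=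
  ⟨hS.one_le, fun _ _ => zero_le_one⟩

theorem IsDecDomain.pos (hS : IsDecDomain S D) {p : ι × ℝ} (hp : p ∈ S) : 0 < p.2 :=
  zero_lt_one.trans_le (hS.one_le p hp)

theorem Dec.add (hf : Dec S D k f) (hg : Dec S D k g) : Dec S D k (fun p => f p + g p) := by
  obtain ⟨C, hC, hf⟩ := hf
  obtain ⟨C', hC', hg⟩ := hg
  refine ⟨C + C', by positivity, fun p hp => ?_⟩
  linarith [norm_add_le (f p) (g p), hf p hp, hg p hp]

theorem Dec.neg (hf : Dec S D k f) : Dec S D k (fun p => -f p) := by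
  simpa only [Dec, norm_neg] using hf

theorem Dec.sub (hf : Dec S D k f) (hg : Dec S D k g) : Dec S D k (fun p => f p - g p) := by
  simpa only [sub_eq_add_neg] using hf.add hg.neg

theorem Dec.congr (hf : Dec S D k f) (h : ∀ p ∈ S, f p = g p) : Dec S D k g := by
  obtain ⟨C, hC, hf⟩ := hf
  exact ⟨C, hC, fun p hp => h p hp ▸ hf p hp⟩

theorem Dec.mono (hS : IsDecDomain S D) (hf : Dec S D k f) (hjk : j ≤ k) : Dec S D j f := by
  obtain ⟨C, hC, hf⟩ := hf
  refine ⟨C, hC, fun p hp => (hf p hp).trans ?_⟩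
  have h1 := hS.one_le p hp
  have h2 := hS.nonneg p hp
  gcongr

theorem Dec.of_le {f' : ι × ℝ → F'} (hf : Dec S D k f) (C : ℝ)
    (h : ∀ p ∈ S, ‖f' p‖ ≤ C * ‖f p‖) : Dec S D k f' := by
  obtain ⟨C', hC', hf⟩ := hf
  refine ⟨|C| * C', by positivity, fun p hp => (h p hp).trans ?_⟩
  rw [mul_assoc]
  exact mul_le_mul (le_abs_self C) (hf p hp) (norm_nonneg _) (abs_nonneg C)

/-- Multiplication rule for decay estimates, in the form of a bound by a product. -/
theorem Dec.of_le_mul {F'' : Type*} [NormedAddCommGroup F''] (hS : IsDecDomain S D)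
    {f' : ι × ℝ → F'} {h : ι × ℝ → F''} {l : ℕ} (hf : Dec S (fun _ => 1) j f) (hg : Dec S D k f')
    (hl : l ≤ j + k) (C : ℝ) (hh : ∀ p ∈ S, ‖h p‖ ≤ C * (‖f p‖ * ‖f' p‖)) : Dec S D l h := by
  obtain ⟨C₁, hC₁, hf⟩ := hf
  obtain ⟨C₂, hC₂, hg⟩ := hg
  refine Dec.mono hS ⟨|C| * (C₁ * C₂), by positivity, fun p hp => (hh p hp).trans ?_⟩ hl
  have hp2 := hS.pos hp
  have hD := hS.nonneg p hp
  rw [mul_assoc]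
  refine mul_le_mul (le_abs_self C) ?_ (by positivity) (abs_nonneg C)
  refine (mul_le_mul (hf p hp) (hg p hp) (norm_nonneg _) (by positivity)).trans_eq ?_
  rw [pow_add]
  field_simp

theorem Dec.smul {𝕜 : Type*} [NormedField 𝕜] [NormedSpace 𝕜 F] (hS : IsDecDomain S D)
    {a : ι × ℝ → 𝕜} {l : ℕ} (ha : Dec S (fun _ => 1) j a) (hf : Dec S D k f) (hl : l ≤ j + k) :
    Dec S D l (fun p => a p • f p) :=
  Dec.of_le_mul hS ha hf hl 1 fun p _ => by rw [norm_smul, one_mul]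

theorem Dec.smul' {𝕜 : Type*} [NormedField 𝕜] [NormedSpace 𝕜 F] (hS : IsDecDomain S D)
    {a : ι × ℝ → 𝕜} {l : ℕ} (ha : Dec S D j a) (hf : Dec S (fun _ => 1) k f) (hl : l ≤ k + j) :
    Dec S D l (fun p => a p • f p) :=
  Dec.of_le_mul hS hf ha hl 1 fun p _ => by rw [norm_smul, one_mul, mul_comm]

theorem dec_const (c : F) : Dec S (fun _ => 1) 0 (fun _ => c) :=
  ⟨‖c‖, norm_nonneg c, fun p _ => by simp⟩

theorem dec_pow_inv (hS : IsDecDomain S D) (c : ℝ) (k : ℕ) :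
    Dec S (fun _ => 1) k (fun p => c / p.2 ^ k) :=
  ⟨|c|, abs_nonneg c, fun p hp => by
    have := hS.pos hp
    rw [Real.norm_eq_abs, abs_div, abs_of_pos (pow_pos this k), div_eq_mul_one_div]⟩

theorem Dec.div_pow (hS : IsDecDomain S D) {f : ι × ℝ → ℝ} (hf : Dec S D k f) {i l : ℕ}
    (hl : l ≤ i + k) : Dec S D l (fun p => f p / p.2 ^ i) :=
  Dec.of_le_mul hS (dec_pow_inv hS 1 i) hf hl 1 fun p hp => by
    rw [div_eq_mul_one_div, norm_mul, one_mul, mul_comm]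

theorem Dec.of_bound {C : ℝ} (h : ∀ p ∈ S, ‖f p‖ ≤ C) : Dec S (fun _ => 1) 0 f :=
  ⟨|C|, abs_nonneg C, fun p hp => by simpa using (h p hp).trans (le_abs_self C)⟩

theorem Dec.mul_id (hS : IsDecDomain S D) {f : ι × ℝ → ℝ} (hf : Dec S D (k + 1) f) :
    Dec S D k (fun p => p.2 * f p) := by
  obtain ⟨C, hC, hf⟩ := hf
  refine ⟨C, hC, fun p hp => ?_⟩
  have hp2 := hS.pos hp
  rw [norm_mul, Real.norm_eq_abs, abs_of_pos hp2]
  refine (mul_le_mul_of_nonneg_left (hf p hp) hp2.le).trans_eq ?_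
  rw [pow_succ]
  field_simp

variable [NormedSpace ℝ F]

theorem norm_le_add_of_hasDerivAt_of_norm_le {h h' : ℝ → F} {C a b : ℝ} {k : ℕ} (ha : 0 < a)
    (hab : a ≤ b) (hd : ∀ t ∈ Set.Icc a b, HasDerivAt h (h' t) t)
    (hb : ∀ t ∈ Set.Icc a b, ‖h' t‖ ≤ C / t ^ (k + 2)) :
    ‖h a‖ ≤ ‖h b‖ + C / a ^ (k + 1) := by
  have hC : 0 ≤ C := by
    have h1 := (norm_nonneg _).trans (hb a ⟨le_rfl, hab⟩)
    by_contra hC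
    exact absurd h1 (not_le.2 (div_neg_of_neg_of_pos (not_le.1 hC) (pow_pos ha _)))
  have key : ‖h b - h a‖ ≤ C / a ^ (k + 1) - C / b ^ (k + 1) := by
    have hB : ∀ t ∈ Set.Icc a b, HasDerivAt (fun t => C / a ^ (k + 1) - C / t ^ (k + 1))
        (C * ((k : ℝ) + 1) / t ^ (k + 2)) t := by
      intro t ht
      have ht0 : 0 < t := ha.trans_le ht.1
      refine HasDerivAt.congr_deriv ((hasDerivAt_const t (C / a ^ (k + 1))).sub
        ((hasDerivAt_const t C).div (hasDerivAt_pow (k + 1) t) (by positivity))) ?_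
      simp only [Nat.add_sub_cancel]
      push_cast
      field_simp
      ring
    refine image_norm_le_of_norm_deriv_right_le_deriv_boundary'
      (f := fun t => h t - h a) (f' := h') (B := fun t => C / a ^ (k + 1) - C / t ^ (k + 1))
      (B' := fun t => C * ((k : ℝ) + 1) / t ^ (k + 2)) (a := a) (b := b)
      (fun t ht => ((hd t ht).continuousAt.sub continuousAt_const).continuousWithinAt)
      (fun t ht => ((hd t ⟨ht.1, ht.2.le⟩).sub_const _).hasDerivWithinAt) (by simp)
      (fun t ht => (hB t ht).continuousAt.continuousWithinAt)
      (fun t ht => (hB t ⟨ht.1, ht.2.le⟩).hasDerivWithinAt) (fun t ht => ?_) ⟨hab, le_rfl⟩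
    have ht0 : 0 < t := ha.trans_le ht.1
    refine (hb t ⟨ht.1, ht.2.le⟩).trans ?_
    gcongr
    nlinarith [(Nat.cast_nonneg k : (0 : ℝ) ≤ k)]
  have h2 : ‖h a‖ ≤ ‖h b‖ + ‖h b - h a‖ := norm_le_norm_add_norm_sub _ _
  have h3 : 0 ≤ C / b ^ (k + 1) := div_nonneg hC (pow_pos (ha.trans_le hab) _).le
  linarith

theorem Dec.of_hasDerivAt (hS : IsDecDomain S D) {h h' : ι × ℝ → F}
    (hd : ∀ p ∈ S, HasDerivAt (fun s => h (p.1, s)) (h' p) p.2) (hh' : Dec S D (k + 2) h')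
    (hend : ControlledAtEnd S D (k + 1) h) : Dec S D (k + 1) h := by
  obtain ⟨C, hC, hh'⟩ := hh'
  obtain ⟨C', hC', hend⟩ := hend
  refine ⟨C' + C, by positivity, fun p hp => le_of_forall_pos_le_add fun η hη => ?_⟩
  obtain ⟨t, hpt, htS, ht⟩ := hend p hp η hη
  have := norm_le_add_of_hasDerivAt_of_norm_le (h := fun s => h (p.1, s))
    (h' := fun s => h' (p.1, s)) (C := C * D p.1) (k := k) (hS.pos hp) hpt
    (fun τ hτ => hd (p.1, τ) (htS τ hτ))
    (fun τ hτ => (hh' (p.1, τ) (htS τ hτ)).trans_eq (by simp [mul_div_assoc]))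
  have e : C * D p.1 / p.2 ^ (k + 1) = C * (D p.1 / p.2 ^ (k + 1)) := by ring
  have e' : h (p.1, p.2) = h p := rfl
  simp only [e, e'] at this
  linarith

end Decay

section Estimates

variable {K : Type*} [NormedAddCommGroup K] [InnerProductSpace ℂ K] [CompleteSpace K]
variable {ι : Type*} {S : Set (ι × ℝ)} {D : ι → ℝ} {k : ℕ}

theorem dec_inner_sub_inner (hS : IsDecDomain S D) {f g f' g' : ι × ℝ → K}
    (hf : Dec S (fun _ => 1) 0 f) (hg' : Dec S (fun _ => 1) 0 g')
    (hff' : Dec S D k (fun p => f p - f' p)) (hgg' : Dec S D k (fun p => g p - g' p)) :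
    Dec S D k (fun p => ⟪f p, g p⟫_ℂ - ⟪f' p, g' p⟫_ℂ) := by
  have h1 : Dec S D k (fun p => ⟪f p, g p - g' p⟫_ℂ) :=
    Dec.of_le_mul hS hf hgg' (by simp) 1 fun p _ => by
      rw [one_mul]; exact norm_inner_le_norm _ _
  have h2 : Dec S D k (fun p => ⟪f p - f' p, g' p⟫_ℂ) :=
    Dec.of_le_mul hS hg' hff' (by simp) 1 fun p _ => by
      rw [one_mul, mul_comm]; exact norm_inner_le_norm _ _
  refine (h1.add h2).congr fun p _ => ?_
  rw [inner_sub_right, inner_sub_left]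
  ring

theorem Dec.re {f : ι × ℝ → ℂ} (hf : Dec S D k f) : Dec S D k (fun p => (f p).re) :=
  hf.of_le 1 fun p _ => by rw [one_mul]; exact Complex.abs_re_le_norm _

theorem Dec.im {f : ι × ℝ → ℂ} (hf : Dec S D k f) : Dec S D k (fun p => (f p).im) :=
  hf.of_le 1 fun p _ => by rw [one_mul]; exact Complex.abs_im_le_norm _

theorem Dec.ofReal {f : ι × ℝ → ℝ} (hf : Dec S D k f) : Dec S D k (fun p => (f p : ℂ)) :=
  hf.of_le 1 fun p _ => by simp

theorem Dec.clm {f : ι × ℝ → K} (hf : Dec S D k f) (L : K →L[ℂ] K) :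
    Dec S D k (fun p => L (f p)) :=
  hf.of_le ‖L‖ fun _ _ => L.le_opNorm _

theorem dec_normSq_sub_normSq (hS : IsDecDomain S D) {f f' : ι × ℝ → K}
    (hf : Dec S (fun _ => 1) 0 f) (hf' : Dec S (fun _ => 1) 0 f')
    (hff' : Dec S D k (fun p => f p - f' p)) :
    Dec S D k (fun p => ‖f p‖ ^ 2 - ‖f' p‖ ^ 2) := by
  refine (dec_inner_sub_inner hS hf hf' hff' hff').re.congr fun p _ => ?_
  rw [Complex.sub_re, inner_self_eq_norm_sq_to_K, inner_self_eq_norm_sq_to_K]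
  norm_cast

theorem dec_lzFlux_sub (hS : IsDecDomain S D) (G : K →L[ℂ] K) {x y x' y' : ι × ℝ → K}
    (hx : Dec S (fun _ => 1) 0 x) (hy : Dec S (fun _ => 1) 0 y)
    (hx' : Dec S (fun _ => 1) 0 x') (hy' : Dec S (fun _ => 1) 0 y')
    (hxx' : Dec S D k (fun p => x p - x' p)) (hyy' : Dec S D k (fun p => y p - y' p)) :
    Dec S D k (fun p => lzFlux G (x p) (y p) - lzFlux G (x' p) (y' p)) := by
  have h1 := dec_normSq_sub_normSq hS (hx.clm (adjoint G)) (hx'.clm (adjoint G))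
    ((hxx'.clm (adjoint G)).congr fun p _ => map_sub _ _ _)
  have h2 := dec_normSq_sub_normSq hS (hy.clm G) (hy'.clm G)
    ((hyy'.clm G).congr fun p _ => map_sub _ _ _)
  refine (h1.sub h2).congr fun p _ => ?_
  simp only [lzFlux]
  ring

/-- `k` is differentiable at `n` with derivative `c`, and `k` differs from its linearization by a
quantity that is locally controlled by the distance to `n`. -/
def HasQuadBound (k : ℝ → ℝ) (E n c : ℝ) : Prop :=
  ∃ C, ∀ a ∈ Set.Icc 0 E, ∀ b ∈ Set.Icc 0 E,
    |k a - k b - c * (a - b)| ≤ C * ((|a - n| + |b - n|) * |a - b|)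

theorem HasQuadBound.lipschitz {k : ℝ → ℝ} {E n c : ℝ} (h : HasQuadBound k E n c)
    (hn : n ∈ Set.Icc 0 E) :
    ∃ L, ∀ a ∈ Set.Icc 0 E, ∀ b ∈ Set.Icc 0 E, |k a - k b| ≤ L * |a - b| := by
  obtain ⟨C, h⟩ := h
  refine ⟨|C| * (2 * E) + |c|, fun a ha b hb => ?_⟩
  have h1 : |a - n| ≤ E := by
    rw [abs_le]; constructor <;> linarith [ha.1, ha.2, hn.1, hn.2]
  have h2 : |b - n| ≤ E := by
    rw [abs_le]; constructor <;> linarith [hb.1, hb.2, hn.1, hn.2]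
  have h3 : |k a - k b - c * (a - b)| ≤ |C| * (2 * E) * |a - b| := by
    refine (h a ha b hb).trans ?_
    rw [mul_assoc]
    refine mul_le_mul (le_abs_self C) ?_ (by positivity) (abs_nonneg C)
    gcongr
    linarith
  calc |k a - k b| = |(k a - k b - c * (a - b)) + c * (a - b)| := by ring_nf
    _ ≤ |k a - k b - c * (a - b)| + |c * (a - b)| := abs_add_le _ _
    _ ≤ (|C| * (2 * E) + |c|) * |a - b| := by rw [abs_mul, add_mul]; linarith

/-- The regularity assumptions on the scalar nonlinearities and on the primitive `Φ` of half their
difference. -/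
structure IsLZReg (k₁ k₂ Φ : ℝ → ℝ) (E n c₁ c₂ : ℝ) : Prop where
  mem : n ∈ Set.Icc 0 E
  quad_fst : HasQuadBound k₁ E n c₁
  quad_snd : HasQuadBound k₂ E n c₂
  hasDerivAt : ∀ a, HasDerivAt Φ (halfDiff k₁ k₂ a) a
  apply_eq_zero : Φ n = 0

namespace IsLZReg

variable {k₁ k₂ Φ : ℝ → ℝ} {E n c₁ c₂ : ℝ}

theorem lipschitz_halfDiff (h : IsLZReg k₁ k₂ Φ E n c₁ c₂) :
    ∃ L, ∀ a ∈ Set.Icc 0 E, ∀ b ∈ Set.Icc 0 E,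
      |halfDiff k₁ k₂ a - halfDiff k₁ k₂ b| ≤ L * |a - b| := by
  obtain ⟨L₁, h₁⟩ := h.quad_fst.lipschitz h.mem
  obtain ⟨L₂, h₂⟩ := h.quad_snd.lipschitz h.mem
  refine ⟨(L₁ + L₂) / 2, fun a ha b hb => ?_⟩
  have e : halfDiff k₁ k₂ a - halfDiff k₁ k₂ b = (k₁ a - k₁ b) / 2 - (k₂ a - k₂ b) / 2 := by
    simp only [halfDiff]; ring
  rw [e]
  refine (abs_sub _ _).trans ?_
  rw [abs_div, abs_div, abs_two]
  linarith [h₁ a ha b hb, h₂ a ha b hb]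

theorem lipschitz_primitive (h : IsLZReg k₁ k₂ Φ E n c₁ c₂) :
    ∃ L, ∀ a ∈ Set.Icc 0 E, ∀ b ∈ Set.Icc 0 E, |Φ a - Φ b| ≤ L * |a - b| := by
  obtain ⟨L, hL⟩ := h.lipschitz_halfDiff
  refine ⟨|L| * E + |halfDiff k₁ k₂ n|, fun a ha b hb => ?_⟩
  refine (convex_Icc (0 : ℝ) E).norm_image_sub_le_of_norm_hasDerivWithin_le (f := Φ)
    (f' := halfDiff k₁ k₂) (fun t _ => (h.hasDerivAt t).hasDerivWithinAt) (fun t ht => ?_) hb ha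
  have h1 : |t - n| ≤ E := by
    rw [abs_le]; constructor <;> linarith [ht.1, ht.2, h.mem.1, h.mem.2]
  have h2 : |halfDiff k₁ k₂ t - halfDiff k₁ k₂ n| ≤ |L| * E :=
    (hL t ht n h.mem).trans (mul_le_mul (le_abs_self L) h1 (abs_nonneg _) (abs_nonneg L))
  rw [Real.norm_eq_abs]
  linarith [abs_sub_abs_le_abs_sub (halfDiff k₁ k₂ t) (halfDiff k₁ k₂ n)]

end IsLZReg

namespace IsLZPair

variable {G : K →L[ℂ] K} {k₁ k₂ Φ : ℝ → ℝ} {E n c₁ c₂ : ℝ} {x y x' y' : ι → ℝ → K}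

theorem normSq_mem {x y : ℝ → K} (h : IsLZPair G k₁ k₂ E x y) (s : ℝ) :
    ‖x s‖ ^ 2 ∈ Set.Icc 0 E :=
  ⟨by positivity, by nlinarith [h.normSq_add s, sq_nonneg ‖y s‖]⟩

theorem dec_fst (h : ∀ i, IsLZPair G k₁ k₂ E (x i) (y i)) :
    Dec S (fun _ => 1) 0 (fun p => x p.1 p.2) :=
  Dec.of_bound (C := Real.sqrt E) fun p _ => Real.le_sqrt_of_sq_le ((h p.1).normSq_mem p.2).2

theorem dec_snd (h : ∀ i, IsLZPair G k₁ k₂ E (x i) (y i)) :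
    Dec S (fun _ => 1) 0 (fun p => y p.1 p.2) :=
  Dec.of_bound (C := Real.sqrt E) fun p _ => Real.le_sqrt_of_sq_le (by
    nlinarith [(h p.1).normSq_add p.2, sq_nonneg ‖x p.1 p.2‖])

theorem dec_inner (hS : IsDecDomain S D) (h : ∀ i, IsLZPair G k₁ k₂ E (x i) (y i)) :
    Dec S (fun _ => 1) 0 (fun p => ⟪x p.1 p.2, G (y p.1 p.2)⟫_ℂ) :=
  Dec.of_le_mul hS.one (dec_fst h) ((dec_snd h).clm G) le_rfl 1 fun p _ => by
    rw [one_mul]; exact norm_inner_le_norm _ _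

theorem dec_flux (hS : IsDecDomain S D) (h : ∀ i, IsLZPair G k₁ k₂ E (x i) (y i)) :
    Dec S (fun _ => 1) 0 (fun p => lzFlux G (x p.1 p.2) (y p.1 p.2)) := by
  have h0 : Dec S (fun _ => 1) 0 (fun _ => (0 : K)) := dec_const 0
  refine (dec_lzFlux_sub hS.one G (dec_fst h) (dec_snd h) h0 h0
    ((dec_fst h).sub h0) ((dec_snd h).sub h0)).congr fun p _ => ?_
  simp [lzFlux]

theorem dec_primitive (hr : IsLZReg k₁ k₂ Φ E n c₁ c₂)
    (h : ∀ i, IsLZPair G k₁ k₂ E (x i) (y i))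
    (hN : Dec S D k (fun p => ‖x p.1 p.2‖ ^ 2 - n)) :
    Dec S D k (fun p => Φ (‖x p.1 p.2‖ ^ 2)) := by
  obtain ⟨L, hL⟩ := hr.lipschitz_primitive
  refine hN.of_le L fun p _ => ?_
  simpa [hr.apply_eq_zero] using hL _ ((h p.1).normSq_mem p.2) n hr.mem

theorem dec_halfDiff (hr : IsLZReg k₁ k₂ Φ E n c₁ c₂)
    (h : ∀ i, IsLZPair G k₁ k₂ E (x i) (y i))
    (hN : Dec S D k (fun p => ‖x p.1 p.2‖ ^ 2 - n)) :
    Dec S D k (fun p => halfDiff k₁ k₂ (‖x p.1 p.2‖ ^ 2) - halfDiff k₁ k₂ n) := by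
  obtain ⟨L, hL⟩ := hr.lipschitz_halfDiff
  exact hN.of_le L fun p _ => hL _ ((h p.1).normSq_mem p.2) n hr.mem

theorem dec_primitive_sub (hr : IsLZReg k₁ k₂ Φ E n c₁ c₂)
    (h : ∀ i, IsLZPair G k₁ k₂ E (x i) (y i)) (h' : ∀ i, IsLZPair G k₁ k₂ E (x' i) (y' i))
    (hN : Dec S D k (fun p => ‖x p.1 p.2‖ ^ 2 - ‖x' p.1 p.2‖ ^ 2)) :
    Dec S D k (fun p => Φ (‖x p.1 p.2‖ ^ 2) - Φ (‖x' p.1 p.2‖ ^ 2)) := by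
  obtain ⟨L, hL⟩ := hr.lipschitz_primitive
  exact hN.of_le L fun p _ => hL _ ((h p.1).normSq_mem p.2) _ ((h' p.1).normSq_mem p.2)

theorem dec_halfDiff_sub (hr : IsLZReg k₁ k₂ Φ E n c₁ c₂)
    (h : ∀ i, IsLZPair G k₁ k₂ E (x i) (y i)) (h' : ∀ i, IsLZPair G k₁ k₂ E (x' i) (y' i))
    (hN : Dec S D k (fun p => ‖x p.1 p.2‖ ^ 2 - ‖x' p.1 p.2‖ ^ 2)) :
    Dec S D k (fun p => halfDiff k₁ k₂ (‖x p.1 p.2‖ ^ 2)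
      - halfDiff k₁ k₂ (‖x' p.1 p.2‖ ^ 2)) := by
  obtain ⟨L, hL⟩ := hr.lipschitz_halfDiff
  exact hN.of_le L fun p _ => hL _ ((h p.1).normSq_mem p.2) _ ((h' p.1).normSq_mem p.2)

theorem dec_normSq_sub_zero (hS : IsDecDomain S D) (h : ∀ i, IsLZPair G k₁ k₂ E (x i) (y i)) :
    Dec S (fun _ => 1) 0 (fun p => ‖x p.1 p.2‖ ^ 2 - n) := by
  have h0 : Dec S (fun _ => 1) 0 (fun _ => (0 : K)) := dec_const 0
  refine ((dec_normSq_sub_normSq hS.one (dec_fst h) h0 ((dec_fst h).sub h0)).sub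
    (dec_const n)).congr fun p _ => ?_
  simp

theorem dec_normSq_sub (hS : IsDecDomain S D) (hr : IsLZReg k₁ k₂ Φ E n c₁ c₂)
    (h : ∀ i, IsLZPair G k₁ k₂ E (x i) (y i))
    (hend : ControlledAtEnd S (fun _ => 1) 1
      (fun p => lzEnergy G Φ n (x p.1) (y p.1) p.2 / p.2)) :
    Dec S (fun _ => 1) 1 (fun p => ‖x p.1 p.2‖ ^ 2 - n) := by
  have h1 := ((dec_primitive hr h (dec_normSq_sub_zero (n := n) hS h)).add (dec_inner hS h).re)
  have h2 := Dec.of_hasDerivAt hS.one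
    (fun p hp => (h p.1).hasDerivAt_lzEnergy_div n hr.hasDerivAt (hS.pos hp).ne')
    (h1.div_pow hS.one (i := 2) (l := 2) (by simp)).neg hend
  refine (h2.sub (h1.div_pow hS.one (i := 1) (l := 1) (by simp))).congr fun p hp => ?_
  have := (hS.pos hp).ne'
  simp only [lzEnergy]
  field_simp
  ring

theorem dec_lzEnergy (hS : IsDecDomain S D) (hr : IsLZReg k₁ k₂ Φ E n c₁ c₂)
    (h : ∀ i, IsLZPair G k₁ k₂ E (x i) (y i))
    (hN : Dec S (fun _ => 1) 1 (fun p => ‖x p.1 p.2‖ ^ 2 - n))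
    (hend : ControlledAtEnd S (fun _ => 1) 2
      (fun p => lzEnergy G Φ n (x p.1) (y p.1) p.2 / p.2
        - (⟪x p.1 p.2, G (y p.1 p.2)⟫_ℂ).im / (2 * p.2 ^ 3))) :
    Dec S (fun _ => 1) 1 (fun p => lzEnergy G Φ n (x p.1) (y p.1) p.2) := by
  have hm : Dec S (fun _ => 1) 0 (fun p => halfDiff k₁ k₂ (‖x p.1 p.2‖ ^ 2)) :=
    ((dec_halfDiff hr h (dec_normSq_sub_zero (n := n) hS h)).add
      (dec_const (halfDiff k₁ k₂ n))).congr fun p _ => by ring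
  have h1 := (dec_primitive hr h hN).div_pow hS.one (i := 2) (l := 3) (by simp)
  have h2 := ((hm.smul hS.one (dec_inner hS h).re le_rfl).sub
    (((dec_const (1 / 2 : ℝ)).smul hS.one (dec_flux hS h) le_rfl))).div_pow hS.one
      (i := 3) (l := 3) (by simp)
  have h3 := ((dec_const (3 / 2 : ℝ)).smul hS.one (dec_inner hS h).im le_rfl).div_pow hS.one
    (i := 4) (l := 3) (by simp)
  have h4 := Dec.of_hasDerivAt hS.one
    (fun p hp => (h p.1).hasDerivAt_lzEnergy_div_sub n hr.hasDerivAt (hS.pos hp).ne')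
    (((h1.neg.add h2).add h3).congr fun p _ => by simp only [smul_eq_mul]; ring) hend
  have h5 := ((dec_const (1 / 2 : ℝ)).smul hS.one (dec_inner hS h).im le_rfl).div_pow hS.one
    (i := 3) (l := 2) (by simp)
  refine ((h4.add h5).mul_id hS.one).congr fun p hp => ?_
  have := (hS.pos hp).ne'
  simp only [smul_eq_mul]
  field_simp
  ring

theorem dec_normSq_sub_normSq' (hS : IsDecDomain S D) (hr : IsLZReg k₁ k₂ Φ E n c₁ c₂)
    (h : ∀ i, IsLZPair G k₁ k₂ E (x i) (y i)) (h' : ∀ i, IsLZPair G k₁ k₂ E (x' i) (y' i))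
    (hx : Dec S D 0 (fun p => x p.1 p.2 - x' p.1 p.2))
    (hy : Dec S D 0 (fun p => y p.1 p.2 - y' p.1 p.2))
    (hend : ControlledAtEnd S D 1
      (fun p => lzEnergy G Φ n (x p.1) (y p.1) p.2 / p.2
        - lzEnergy G Φ n (x' p.1) (y' p.1) p.2 / p.2)) :
    Dec S D 1 (fun p => ‖x p.1 p.2‖ ^ 2 - ‖x' p.1 p.2‖ ^ 2) := by
  have hN := dec_normSq_sub_normSq hS (dec_fst h) (dec_fst h') hx
  have hX := (dec_inner_sub_inner hS (dec_fst h) ((dec_snd h').clm G) hx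
    ((hy.clm G).congr fun p _ => map_sub _ _ _)).re
  have h1 := (dec_primitive_sub hr h h' hN).add hX
  have h2 := Dec.of_hasDerivAt hS
    (fun p hp => ((h p.1).hasDerivAt_lzEnergy_div n hr.hasDerivAt (hS.pos hp).ne').sub
      ((h' p.1).hasDerivAt_lzEnergy_div n hr.hasDerivAt (hS.pos hp).ne'))
    ((h1.div_pow hS (i := 2) (l := 2) (by simp)).neg.congr fun p _ => by
      rw [Complex.sub_re]; ring) hend
  refine (h2.sub (h1.div_pow hS (i := 1) (l := 1) (by simp))).congr fun p hp => ?_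
  have := (hS.pos hp).ne'
  simp only [lzEnergy, Complex.sub_re]
  field_simp
  ring

theorem dec_lzEnergy_sub (hS : IsDecDomain S D) (hr : IsLZReg k₁ k₂ Φ E n c₁ c₂)
    (h : ∀ i, IsLZPair G k₁ k₂ E (x i) (y i)) (h' : ∀ i, IsLZPair G k₁ k₂ E (x' i) (y' i))
    (hx : Dec S D 0 (fun p => x p.1 p.2 - x' p.1 p.2))
    (hy : Dec S D 0 (fun p => y p.1 p.2 - y' p.1 p.2))
    (hN : Dec S D 1 (fun p => ‖x p.1 p.2‖ ^ 2 - ‖x' p.1 p.2‖ ^ 2))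
    (hend : ControlledAtEnd S D 2
      (fun p => (lzEnergy G Φ n (x p.1) (y p.1) p.2 / p.2
          - (⟪x p.1 p.2, G (y p.1 p.2)⟫_ℂ).im / (2 * p.2 ^ 3))
        - (lzEnergy G Φ n (x' p.1) (y' p.1) p.2 / p.2
          - (⟪x' p.1 p.2, G (y' p.1 p.2)⟫_ℂ).im / (2 * p.2 ^ 3)))) :
    Dec S D 1 (fun p => lzEnergy G Φ n (x p.1) (y p.1) p.2
      - lzEnergy G Φ n (x' p.1) (y' p.1) p.2) := by
  have hm : Dec S (fun _ => 1) 0 (fun p => halfDiff k₁ k₂ (‖x p.1 p.2‖ ^ 2)) :=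
    ((dec_halfDiff hr h (dec_normSq_sub_zero (n := n) hS h)).add
      (dec_const (halfDiff k₁ k₂ n))).congr fun p _ => by ring
  have hX := dec_inner_sub_inner hS (dec_fst h) ((dec_snd h').clm G) hx
    ((hy.clm G).congr fun p _ => map_sub _ _ _)
  have hκ := dec_lzFlux_sub hS G (dec_fst h) (dec_snd h) (dec_fst h') (dec_snd h') hx hy
  have hmm := dec_halfDiff_sub hr h h' hN
  have h1 := (dec_primitive_sub hr h h' hN).div_pow hS (i := 2) (l := 3) (by simp)
  have h2 := (((hm.smul hS hX.re (l := 0) le_rfl).add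
    (hmm.smul' hS (dec_inner hS h').re (l := 0) (by simp))).sub
    (((dec_const (1 / 2 : ℝ)).smul hS hκ le_rfl))).div_pow hS (i := 3) (l := 3) (by simp)
  have h3 := ((dec_const (3 / 2 : ℝ)).smul hS hX.im le_rfl).div_pow hS
    (i := 4) (l := 3) (by simp)
  have h4 := Dec.of_hasDerivAt hS
    (fun p hp => ((h p.1).hasDerivAt_lzEnergy_div_sub n hr.hasDerivAt (hS.pos hp).ne').sub
      ((h' p.1).hasDerivAt_lzEnergy_div_sub n hr.hasDerivAt (hS.pos hp).ne'))
    (((h1.neg.add h2).add h3).congr fun p _ => by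
      simp only [smul_eq_mul, Complex.sub_re, Complex.sub_im]; ring) hend
  have h5 := ((dec_const (1 / 2 : ℝ)).smul hS hX.im le_rfl).div_pow hS
    (i := 3) (l := 2) (by simp)
  refine ((h4.add h5).mul_id hS).congr fun p hp => ?_
  have := (hS.pos hp).ne'
  simp only [smul_eq_mul, Complex.sub_im]
  field_simp
  ring

end IsLZPair

end Estimates

section Vector

variable {K : Type*} [NormedAddCommGroup K] [InnerProductSpace ℂ K] [CompleteSpace K]

/-- The coefficient `1/(2s) - m₀/(2s²)` of the adiabatic normal form. -/
def normalCoeff (m₀ s : ℝ) : ℝ := 1 / (2 * s) - m₀ / (2 * s ^ 2)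

/-- The adiabatic normal form `x + ε g(s) B y`. -/
def normalForm (B : K →L[ℂ] K) (ε m₀ : ℝ) (s : ℝ) (x y : K) : K :=
  x + ((ε * normalCoeff m₀ s : ℝ) : ℂ) • B y

/-- The remainder in the equation for the adiabatic normal form. -/
def normalRem (B : K →L[ℂ] K) (ε m₀ m s : ℝ) (x y : K) : K :=
  (I * ((-(ε * m₀ / 2) / s ^ 2 : ℝ) : ℂ)) • B (adjoint B x)
    + (I * ((-(normalCoeff m₀ s / (2 * s)) : ℝ) : ℂ)) • B (adjoint B (B y))
    + (I * ((-((m - m₀) / s) + m * m₀ / s ^ 2 : ℝ) : ℂ)) • B y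
    + ((ε * (-(1 / 2) / s ^ 2 + m₀ / s ^ 3) : ℝ) : ℂ) • B y

/-- The normal form in the interaction picture, with the phase `c w` removed. -/
def interaction (B : K →L[ℂ] K) (ε m₀ c : ℝ) (V : ℝ → K →L[ℂ] K) (w : ℝ → ℝ) (x y : ℝ → K)
    (s : ℝ) : K :=
  Complex.exp (-(I * ((c * w s : ℝ) : ℂ))) • V s (normalForm B ε m₀ s (x s) (y s))

theorem hasDerivAt_normalCoeff (m₀ : ℝ) {s : ℝ} (hs : s ≠ 0) :
    HasDerivAt (normalCoeff m₀) (-(1 / 2) / s ^ 2 + m₀ / s ^ 3) s := by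
  have h1 : HasDerivAt (fun s : ℝ => 2 * s) 2 s := by
    simpa using (hasDerivAt_id s).const_mul 2
  have h2 : HasDerivAt (fun s : ℝ => 2 * s ^ 2) (2 * (2 * s)) s := by
    simpa using (hasDerivAt_pow 2 s).const_mul 2
  refine HasDerivAt.congr_deriv (((hasDerivAt_const s (1 : ℝ)).div h1 (by positivity)).sub
    ((hasDerivAt_const s m₀).div h2 (by positivity))) ?_
  field_simp
  ring

theorem hasDerivAt_interaction (B : K →L[ℂ] K) {ε : ℝ} (hε : ε ^ 2 = 1) (m₀ c k₀ : ℝ)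
    {V : ℝ → K →L[ℂ] K} {w : ℝ → ℝ} {x y : ℝ → K} {s kx ky w' : ℝ} (hs : s ≠ 0)
    (hV : HasDerivAt V (-(I • (((k₀ + ε * s : ℝ) : ℂ) • V s
      + ((ε / (2 * s) : ℝ) : ℂ) • (V s * (B * adjoint B))))) s)
    (hw : HasDerivAt w w' s)
    (hx : HasDerivAt x (I • (((ε * s + kx : ℝ) : ℂ) • x s + B (y s))) s)
    (hy : HasDerivAt y (I • (adjoint B (x s) + ((-(ε * s) + ky : ℝ) : ℂ) • y s)) s) :
    HasDerivAt (interaction B ε m₀ c V w x y)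
      (Complex.exp (-(I * ((c * w s : ℝ) : ℂ))) • V s
        ((I * ((kx - k₀ - c * w' : ℝ) : ℂ)) • normalForm B ε m₀ s (x s) (y s)
          + normalRem B ε m₀ (ε * (kx - ky) / 2) s (x s) (y s))) s := by
  have hBy : HasDerivAt (fun s => B (y s)) _ s :=
    (B.restrictScalars ℝ).hasFDerivAt.comp_hasDerivAt s hy
  have hg : HasDerivAt (fun s => ((ε * normalCoeff m₀ s : ℝ) : ℂ)) _ s :=
    ((hasDerivAt_normalCoeff m₀ hs).const_mul ε).ofReal_comp
  have hP : HasDerivAt (fun s => normalForm B ε m₀ s (x s) (y s)) _ s := hx.add (hg.smul hBy)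
  have hVR : HasDerivAt (fun s => (V s).restrictScalars ℝ) _ s :=
    (ContinuousLinearMap.restrictScalarsL ℂ K K ℝ ℝ).hasFDerivAt.comp_hasDerivAt s hV
  have hVP : HasDerivAt (fun s => V s (normalForm B ε m₀ s (x s) (y s))) _ s :=
    hVR.clm_apply hP
  have he : HasDerivAt (fun s => Complex.exp (-(I * ((c * w s : ℝ) : ℂ)))) _ s :=
    (((hw.const_mul c).ofReal_comp.const_mul I).neg).cexp
  refine HasDerivAt.congr_deriv (he.smul hVP) ?_
  have e1 : ((-(ε * m₀ / 2) / s ^ 2 : ℝ)) = ε * normalCoeff m₀ s - ε / (2 * s) := by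
    rw [normalCoeff]; field_simp; ring
  have e2 : (-((ε * (kx - ky) / 2 - m₀) / s) + ε * (kx - ky) / 2 * m₀ / s ^ 2)
      = 1 - 2 * normalCoeff m₀ s * s - 2 * normalCoeff m₀ s * (ε * (kx - ky) / 2) := by
    rw [normalCoeff]; field_simp; ring
  have hε' : (ε : ℂ) ^ 2 = 1 := by exact_mod_cast hε
  have hsC : (s : ℂ) ≠ 0 := by exact_mod_cast hs
  simp only [normalRem, e1, e2, normalForm]
  generalize normalCoeff m₀ s = g
  generalize (-(1 / 2) / s ^ 2 + m₀ / s ^ 3) = g'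
  have hR : ∀ L : K →L[ℂ] K, ContinuousLinearMap.restrictScalarsL ℂ K K ℝ ℝ L
      = L.restrictScalars ℝ := fun _ => rfl
  simp only [hR, ContinuousLinearMap.coe_restrictScalars', map_add, map_smul, neg_apply, add_apply,
    smul_apply, mul_apply_eq_comp, Pi.neg_apply, smul_add, smul_smul, smul_neg, neg_add]
  push_cast
  match_scalars
  · ring
  · ring
  · linear_combination (-2 * Complex.exp (-(I * (c * w s))) * I * g * s) * hε'
  · linear_combination (-(Complex.exp (-(I * (c * w s))) * I * g / (2 * s))) * hε'

end Vector

section VectorEstimates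

variable {K : Type*} [NormedAddCommGroup K] [InnerProductSpace ℂ K] [CompleteSpace K]
variable {ι : Type*} {S : Set (ι × ℝ)} {D : ι → ℝ} {k : ℕ}

theorem norm_exp_neg_I_mul (a : ℝ) : ‖Complex.exp (-(I * (a : ℂ)))‖ = 1 := by
  rw [← mul_neg, ← Complex.ofReal_neg, norm_exp_I_mul_ofReal]

theorem norm_exp_neg_I_mul_sub_le (a b : ℝ) :
    ‖Complex.exp (-(I * (a : ℂ))) - Complex.exp (-(I * (b : ℂ)))‖ ≤ |a - b| := by
  have e : Complex.exp (-(I * (a : ℂ))) - Complex.exp (-(I * (b : ℂ)))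
      = Complex.exp (-(I * (b : ℂ))) * (Complex.exp (I * ((b - a : ℝ) : ℂ)) - 1) := by
    rw [mul_sub, ← Complex.exp_add, mul_one]
    congr 2
    push_cast
    ring
  rw [e, norm_mul, norm_exp_neg_I_mul, one_mul, abs_sub_comm]
  exact Real.norm_exp_I_mul_ofReal_sub_one_le

theorem dec_rotation_sub (hS : IsDecDomain S D) {V : ℝ → K →L[ℂ] K}
    (hV : ∀ p ∈ S, ∀ z, ‖V p.2 z‖ = ‖z‖) {a a' : ι × ℝ → ℝ} {z z' : ι × ℝ → K} {j : ℕ}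
    (ha : Dec S D 1 (fun p => a p - a' p)) (hz : Dec S (fun _ => 1) j z) (hk : k ≤ j + 1)
    (hzz' : Dec S D k (fun p => z p - z' p)) :
    Dec S D k (fun p => Complex.exp (-(I * (a p : ℂ))) • V p.2 (z p)
      - Complex.exp (-(I * (a' p : ℂ))) • V p.2 (z' p)) := by
  have h1 : Dec S D k (fun p => (Complex.exp (-(I * (a p : ℂ)))
      - Complex.exp (-(I * (a' p : ℂ)))) • V p.2 (z p)) :=
    Dec.of_le_mul hS hz ha hk 1 fun p hp => by
      rw [norm_smul, hV p hp, one_mul, mul_comm]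
      exact mul_le_mul_of_nonneg_left (norm_exp_neg_I_mul_sub_le _ _) (norm_nonneg _)
  have h2 : Dec S D k (fun p => Complex.exp (-(I * (a' p : ℂ))) • V p.2 (z p - z' p)) :=
    hzz'.of_le 1 fun p hp => by rw [norm_smul, norm_exp_neg_I_mul, hV p hp]
  refine (h1.add h2).congr fun p _ => ?_
  rw [map_sub]
  module

theorem dec_sub_of_rotation_sub (hS : IsDecDomain S D) {V : ℝ → K →L[ℂ] K}
    (hV : ∀ p ∈ S, ∀ z, ‖V p.2 z‖ = ‖z‖) {a a' : ι × ℝ → ℝ} {z z' : ι × ℝ → K}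
    (ha : Dec S D 1 (fun p => a p - a' p)) (hz : Dec S (fun _ => 1) 0 z)
    (hzz' : Dec S D 1 (fun p => Complex.exp (-(I * (a p : ℂ))) • V p.2 (z p)
      - Complex.exp (-(I * (a' p : ℂ))) • V p.2 (z' p))) :
    Dec S D 1 (fun p => z p - z' p) := by
  have h1 : Dec S D 1 (fun p => (Complex.exp (-(I * (a p : ℂ)))
      - Complex.exp (-(I * (a' p : ℂ)))) • V p.2 (z p)) :=
    Dec.of_le_mul hS hz ha le_rfl 1 fun p hp => by
      rw [norm_smul, hV p hp, one_mul, mul_comm]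
      exact mul_le_mul_of_nonneg_left (norm_exp_neg_I_mul_sub_le _ _) (norm_nonneg _)
  have h2 : Dec S D 1 (fun p => Complex.exp (-(I * (a' p : ℂ))) • V p.2 (z p - z' p)) := by
    refine (hzz'.sub h1).congr fun p _ => ?_
    rw [map_sub]
    module
  exact h2.of_le 1 fun p hp => by rw [norm_smul, norm_exp_neg_I_mul, hV p hp, one_mul, one_mul]

theorem dec_normalCoeff (hS : IsDecDomain S D) (m₀ : ℝ) :
    Dec S (fun _ => 1) 1 (fun p => normalCoeff m₀ p.2) := by
  refine ((dec_pow_inv hS.one (1 / 2) 1).sub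
    ((dec_pow_inv hS.one (m₀ / 2) 2).mono hS.one (by simp))).congr fun p hp => ?_
  have := (hS.pos hp).ne'
  simp only [normalCoeff]
  field_simp

theorem dec_normalForm_sub_fst (hS : IsDecDomain S D) (B : K →L[ℂ] K) (ε m₀ : ℝ)
    {x y : ι × ℝ → K} (hy : Dec S D 0 y) :
    Dec S D 1 (fun p => normalForm B ε m₀ p.2 (x p) (y p) - x p) := by
  have h1 := (((dec_const ε).smul hS.one (dec_normalCoeff hS m₀) (l := 1) le_rfl).ofReal).smul hS
    (hy.clm B) (l := 1) le_rfl
  refine h1.congr fun p _ => ?_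
  simp [normalForm]

theorem dec_normalForm (hS : IsDecDomain S D) (B : K →L[ℂ] K) (ε m₀ : ℝ)
    {x y : ι × ℝ → K} (hx : Dec S D 0 x) (hy : Dec S D 0 y) :
    Dec S D 0 (fun p => normalForm B ε m₀ p.2 (x p) (y p)) :=
  (((dec_normalForm_sub_fst hS B ε m₀ (x := x) hy).mono hS zero_le_one).add hx).congr
    fun p _ => by abel

theorem dec_normalRem (hS : IsDecDomain S D) (B : K →L[ℂ] K) (ε m₀ : ℝ)
    {m : ι × ℝ → ℝ} {x y : ι × ℝ → K} (hm : Dec S (fun _ => 1) 1 (fun p => m p - m₀))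
    (hx : Dec S D 0 x) (hy : Dec S D 0 y) :
    Dec S D 2 (fun p => normalRem B ε m₀ (m p) p.2 (x p) (y p)) := by
  have hm0 : Dec S (fun _ => 1) 0 m :=
    ((hm.mono hS.one zero_le_one).add (dec_const m₀)).congr fun p _ => by ring
  have hI : Dec S (fun _ => 1) 0 (fun _ => I) := dec_const I
  have c1 := (hI.smul hS.one (dec_pow_inv hS.one (-(ε * m₀ / 2)) 2).ofReal (l := 2) le_rfl).smul hS
    ((hx.clm (adjoint B)).clm B) (l := 2) le_rfl
  have c2 := (hI.smul hS.one (((dec_pow_inv hS.one (-(1 / 2)) 1).smul hS.one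
    (dec_normalCoeff hS m₀) (l := 2) le_rfl)).ofReal (l := 2) le_rfl).smul hS
    (((hy.clm B).clm (adjoint B)).clm B) (l := 2) le_rfl
  have c3 := (hI.smul hS.one ((hm.div_pow hS.one (i := 1) (l := 2) le_rfl).neg.add
    ((hm0.smul hS.one (dec_const m₀) (l := 0) le_rfl).div_pow hS.one (i := 2) (l := 2)
      le_rfl)).ofReal (l := 2) le_rfl).smul hS (hy.clm B) (l := 2) le_rfl
  have c4 := (((dec_const ε).smul hS.one ((dec_pow_inv hS.one (-(1 / 2)) 2).add
    ((dec_pow_inv hS.one m₀ 3).mono hS.one (by simp))) (l := 2) le_rfl).ofReal).smul hS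
    (hy.clm B) (l := 2) le_rfl
  refine (((c1.add c2).add c3).add c4).congr fun p hp => ?_
  have e : (-(1 / 2) / p.2 * normalCoeff m₀ p.2 : ℝ) = -(normalCoeff m₀ p.2 / (2 * p.2)) := by
    have := (hS.pos hp).ne'
    field_simp
  simp only [normalRem, smul_eq_mul, e, pow_one]

theorem normalRem_sub (B : K →L[ℂ] K) (ε m₀ m m' s : ℝ) (x y x' y' : K) :
    normalRem B ε m₀ m s x y - normalRem B ε m₀ m' s x' y'
      = normalRem B ε m₀ m s (x - x') (y - y')
        + (I * ((-((m - m') / s) + (m - m') * m₀ / s ^ 2 : ℝ) : ℂ)) • B y' := by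
  simp only [normalRem, map_sub]
  push_cast
  module

theorem normalForm_sub (B : K →L[ℂ] K) (ε m₀ s : ℝ) (x y x' y' : K) :
    normalForm B ε m₀ s x y - normalForm B ε m₀ s x' y'
      = normalForm B ε m₀ s (x - x') (y - y') := by
  simp only [normalForm, map_sub]
  module

theorem dec_normalRem_sub (hS : IsDecDomain S D) (B : K →L[ℂ] K) (ε m₀ : ℝ)
    {m m' : ι × ℝ → ℝ} {x y x' y' : ι × ℝ → K}
    (hm : Dec S (fun _ => 1) 1 (fun p => m p - m₀)) (hy' : Dec S (fun _ => 1) 0 y')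
    (hmm' : Dec S D 1 (fun p => m p - m' p))
    (hxx' : Dec S D 0 (fun p => x p - x' p)) (hyy' : Dec S D 0 (fun p => y p - y' p)) :
    Dec S D 2 (fun p => normalRem B ε m₀ (m p) p.2 (x p) (y p)
      - normalRem B ε m₀ (m' p) p.2 (x' p) (y' p)) := by
  have hI : Dec S (fun _ => 1) 0 (fun _ => I) := dec_const I
  have c := (hI.smul hS ((hmm'.div_pow hS (i := 1) (l := 2) le_rfl).neg.add
    ((hmm'.smul' hS (dec_const m₀) (l := 0) (by simp)).div_pow hS (i := 2) (l := 2)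
      le_rfl)).ofReal (l := 2) le_rfl).smul' hS (hy'.clm B) (l := 2) le_rfl
  refine ((dec_normalRem hS B ε m₀ hm hxx' hyy').add c).congr fun p _ => ?_
  rw [normalRem_sub, pow_one, smul_eq_mul, smul_eq_mul]

/-- The velocity of the normal form, before passing to the interaction picture. -/
def normalVel (B : K →L[ℂ] K) (ε m₀ ρ m s : ℝ) (x y : K) : K :=
  (I * (ρ : ℂ)) • normalForm B ε m₀ s x y + normalRem B ε m₀ m s x y

theorem dec_normalVel (hS : IsDecDomain S D) (B : K →L[ℂ] K) (ε m₀ : ℝ)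
    {m ρ : ι × ℝ → ℝ} {x y : ι × ℝ → K} (hm : Dec S (fun _ => 1) 1 (fun p => m p - m₀))
    (hρ : Dec S (fun _ => 1) 2 ρ) (hx : Dec S D 0 x) (hy : Dec S D 0 y) :
    Dec S D 2 (fun p => normalVel B ε m₀ (ρ p) (m p) p.2 (x p) (y p)) :=
  (((dec_const I).smul hS.one hρ.ofReal (l := 2) le_rfl).smul hS
    (dec_normalForm hS B ε m₀ hx hy) (l := 2) le_rfl).add (dec_normalRem hS B ε m₀ hm hx hy)

theorem dec_normalVel_sub (hS : IsDecDomain S D) (B : K →L[ℂ] K) (ε m₀ : ℝ)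
    {m m' ρ ρ' : ι × ℝ → ℝ} {x y x' y' : ι × ℝ → K}
    (hm : Dec S (fun _ => 1) 1 (fun p => m p - m₀)) (hρ : Dec S (fun _ => 1) 2 ρ)
    (hx' : Dec S (fun _ => 1) 0 x') (hy' : Dec S (fun _ => 1) 0 y')
    (hmm' : Dec S D 1 (fun p => m p - m' p)) (hρρ' : Dec S D 2 (fun p => ρ p - ρ' p))
    (hxx' : Dec S D 0 (fun p => x p - x' p)) (hyy' : Dec S D 0 (fun p => y p - y' p)) :
    Dec S D 2 (fun p => normalVel B ε m₀ (ρ p) (m p) p.2 (x p) (y p)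
      - normalVel B ε m₀ (ρ' p) (m' p) p.2 (x' p) (y' p)) := by
  have h1 := ((dec_const I).smul hS.one hρ.ofReal (l := 2) le_rfl).smul hS
    (dec_normalForm hS B ε m₀ hxx' hyy') (l := 2) le_rfl
  have h2 := ((dec_const I).smul hS hρρ'.ofReal (l := 2) le_rfl).smul' hS
    (dec_normalForm hS.one B ε m₀ hx' hy') (l := 2) (by simp)
  refine ((h1.add h2).add (dec_normalRem_sub hS B ε m₀ hm hy' hmm' hxx' hyy')).congr fun p _ => ?_
  simp only [normalVel, ← normalForm_sub, smul_eq_mul]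
  push_cast
  module

end VectorEstimates

section Component

variable {K : Type*} [NormedAddCommGroup K] [InnerProductSpace ℂ K] [CompleteSpace K]
variable {ι : Type*} {S : Set (ι × ℝ)} {D : ι → ℝ} {k : ℕ}

theorem ControlledAtEnd.of_tendsto {F : Type*} [NormedAddCommGroup F] {h : ι × ℝ → F}
    (hS : ∀ p ∈ S, ∀ t, p.2 ≤ t → (p.1, t) ∈ S)
    (hh : ∀ p ∈ S, Tendsto (fun t => h (p.1, t)) atTop (𝓝 0)) : ControlledAtEnd S D k h := by
  refine ⟨0, le_rfl, fun p hp η hη => ?_⟩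
  have h1 := (tendsto_zero_iff_norm_tendsto_zero.1 (hh p hp)).eventually (gt_mem_nhds hη)
  obtain ⟨t, ht, htp⟩ := (h1.and (eventually_ge_atTop p.2)).exists
  exact ⟨t, htp, fun τ hτ => hS p hp τ hτ.1, by linarith⟩

theorem ControlledAtEnd.of_dec {F : Type*} [NormedAddCommGroup F] {h : ι × ℝ → F}
    (hS : IsDecDomain S D) {S' : Set (ι × ℝ)} {T : ι → ℝ}
    (hT : ∀ p ∈ S, p.2 ≤ T p.1 ∧ (∀ τ ∈ Set.Icc p.2 (T p.1), (p.1, τ) ∈ S) ∧ (p.1, T p.1) ∈ S')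
    (hh : Dec S' D k h) : ControlledAtEnd S D k h := by
  obtain ⟨C, hC, hh⟩ := hh
  refine ⟨C, hC, fun p hp η hη => ⟨T p.1, (hT p hp).1, (hT p hp).2.1, ?_⟩⟩
  refine (hh _ (hT p hp).2.2).trans (le_add_of_le_of_nonneg ?_ hη.le)
  have h1 := hS.pos hp
  have h2 := hS.nonneg p hp
  have h3 := (hT p hp).1
  dsimp only
  gcongr

/-- `V` is a family of isometries solving the model equation of the diagonal flow. -/
structure IsModelPhase (B : K →L[ℂ] K) (ε k₀ : ℝ) (V : ℝ → K →L[ℂ] K) : Prop where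
  norm_apply : ∀ s, 0 < s → ∀ z, ‖V s z‖ = ‖z‖
  hasDerivAt : ∀ s, 0 < s → HasDerivAt V (-(I • (((k₀ + ε * s : ℝ) : ℂ) • V s
      + ((ε / (2 * s) : ℝ) : ℂ) • (V s * (B * adjoint B))))) s

/-- One component of the Landau–Zener system, coupled to the other one by `B`. -/
structure IsLZComponent (B : K →L[ℂ] K) (ε : ℝ) (kx ky w w' : ℝ → ℝ) (x y : ℝ → K) : Prop where
  deriv_fst : ∀ s, HasDerivAt x (I • (((ε * s + kx s : ℝ) : ℂ) • x s + B (y s))) s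
  deriv_snd : ∀ s, HasDerivAt y (I • (adjoint B (x s) + ((-(ε * s) + ky s : ℝ) : ℂ) • y s)) s
  deriv_energy : ∀ s, HasDerivAt w (w' s) s

theorem IsLZPair.component_fst {G : K →L[ℂ] K} {k₁ k₂ Φ : ℝ → ℝ} {E n : ℝ} {x y : ℝ → K}
    (h : IsLZPair G k₁ k₂ E x y) (hΦ : ∀ a, HasDerivAt Φ (halfDiff k₁ k₂ a) a) :
    IsLZComponent G 1 (fun s => k₁ (‖x s‖ ^ 2)) (fun s => k₂ (‖x s‖ ^ 2)) (lzEnergy G Φ n x y)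
      (fun s => ‖x s‖ ^ 2 - n) x y where
  deriv_fst s := by simpa only [one_mul] using h.deriv_fst s
  deriv_snd s := by simpa only [one_mul] using h.deriv_snd s
  deriv_energy := h.hasDerivAt_lzEnergy n hΦ

theorem IsLZPair.component_snd {G : K →L[ℂ] K} {k₁ k₂ Φ : ℝ → ℝ} {E n : ℝ} {x y : ℝ → K}
    (h : IsLZPair G k₁ k₂ E x y) (hΦ : ∀ a, HasDerivAt Φ (halfDiff k₁ k₂ a) a) :
    IsLZComponent (adjoint G) (-1) (fun s => k₂ (‖x s‖ ^ 2)) (fun s => k₁ (‖x s‖ ^ 2))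
      (lzEnergy G Φ n x y) (fun s => ‖x s‖ ^ 2 - n) y x where
  deriv_fst s := by
    simpa only [neg_mul, one_mul, add_comm (adjoint G (x s))] using h.deriv_snd s
  deriv_snd s := by
    simpa only [neg_mul, one_mul, neg_neg, adjoint_adjoint, add_comm _ (G (y s))]
      using h.deriv_fst s
  deriv_energy := h.hasDerivAt_lzEnergy n hΦ

variable {B : K →L[ℂ] K} {ε k₀ m₀ c : ℝ} {V : ℝ → K →L[ℂ] K}
  {kx ky w w' kx' ky' v v' : ι → ℝ → ℝ} {x y x' y' : ι → ℝ → K}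

theorem dec_interaction_sub_fst (hS : IsDecDomain S D) (hV : IsModelPhase B ε k₀ V)
    (hw : Dec S (fun _ => 1) 1 (fun p => w p.1 p.2))
    (hx : Dec S (fun _ => 1) 0 (fun p => x p.1 p.2))
    (hy : Dec S (fun _ => 1) 0 (fun p => y p.1 p.2)) :
    Dec S (fun _ => 1) 1
      (fun p => interaction B ε m₀ c V (w p.1) (x p.1) (y p.1) p.2 - V p.2 (x p.1 p.2)) := by
  have hcw := (dec_const c).smul hS.one hw (l := 1) le_rfl
  refine (dec_rotation_sub hS.one (fun p hp => hV.norm_apply p.2 (hS.pos hp))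
    (a := fun p => c * w p.1 p.2) (a' := fun _ => 0)
    (z := fun p => normalForm B ε m₀ p.2 (x p.1 p.2) (y p.1 p.2)) (z' := fun p => x p.1 p.2)
    (hcw.congr fun p _ => by simp) (dec_normalForm hS.one B ε m₀ hx hy) le_rfl
    (dec_normalForm_sub_fst hS.one B ε m₀ hy)).congr fun p _ => ?_
  simp [interaction]

theorem hasDerivAt_interaction_of_component (hε : ε ^ 2 = 1) (hV : IsModelPhase B ε k₀ V)
    {kx ky w w' : ℝ → ℝ} {x y : ℝ → K} (h : IsLZComponent B ε kx ky w w' x y) {s : ℝ}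
    (hs : 0 < s) :
    HasDerivAt (interaction B ε m₀ c V w x y)
      (Complex.exp (-(I * ((c * w s : ℝ) : ℂ))) • V s
        (normalVel B ε m₀ (kx s - k₀ - c * w' s) (ε * (kx s - ky s) / 2) s (x s) (y s))) s :=
  hasDerivAt_interaction B hε m₀ c k₀ hs.ne' (hV.hasDerivAt s hs) (h.deriv_energy s)
    (h.deriv_fst s) (h.deriv_snd s)

theorem dec_model_sub (hS : IsDecDomain S D) (hε : ε ^ 2 = 1) (hV : IsModelPhase B ε k₀ V)
    (h : ∀ i, IsLZComponent B ε (kx i) (ky i) (w i) (w' i) (x i) (y i))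
    (hw : Dec S (fun _ => 1) 1 (fun p => w p.1 p.2))
    (hm : Dec S (fun _ => 1) 1 (fun p => ε * (kx p.1 p.2 - ky p.1 p.2) / 2 - m₀))
    (hρ : Dec S (fun _ => 1) 2 (fun p => kx p.1 p.2 - k₀ - c * w' p.1 p.2))
    (hx : Dec S (fun _ => 1) 0 (fun p => x p.1 p.2))
    (hy : Dec S (fun _ => 1) 0 (fun p => y p.1 p.2)) (ω : K)
    (hend : ControlledAtEnd S (fun _ => 1) 1
      (fun p => interaction B ε m₀ c V (w p.1) (x p.1) (y p.1) p.2 - ω)) :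
    Dec S (fun _ => 1) 1 (fun p => V p.2 (x p.1 p.2) - ω) := by
  have h1 := Dec.of_hasDerivAt hS.one
    (fun p hp => (hasDerivAt_interaction_of_component hε hV (h p.1) (hS.pos hp)).sub_const ω)
    ((dec_normalVel hS.one B ε m₀ hm hρ hx hy).of_le 1 fun p hp => by
      rw [norm_smul, norm_exp_neg_I_mul, hV.norm_apply p.2 (hS.pos hp)]) hend
  exact (h1.sub (dec_interaction_sub_fst hS hV hw hx hy)).congr fun p _ => by abel

theorem dec_fst_sub (hS : IsDecDomain S D) (hε : ε ^ 2 = 1) (hV : IsModelPhase B ε k₀ V)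
    (h : ∀ i, IsLZComponent B ε (kx i) (ky i) (w i) (w' i) (x i) (y i))
    (h' : ∀ i, IsLZComponent B ε (kx' i) (ky' i) (v i) (v' i) (x' i) (y' i))
    (hm : Dec S (fun _ => 1) 1 (fun p => ε * (kx p.1 p.2 - ky p.1 p.2) / 2 - m₀))
    (hρ : Dec S (fun _ => 1) 2 (fun p => kx p.1 p.2 - k₀ - c * w' p.1 p.2))
    (hx : Dec S (fun _ => 1) 0 (fun p => x p.1 p.2))
    (hy : Dec S (fun _ => 1) 0 (fun p => y p.1 p.2))
    (hx' : Dec S (fun _ => 1) 0 (fun p => x' p.1 p.2))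
    (hy' : Dec S (fun _ => 1) 0 (fun p => y' p.1 p.2))
    (hww : Dec S D 1 (fun p => w p.1 p.2 - v p.1 p.2))
    (hmm : Dec S D 1 (fun p => ε * (kx p.1 p.2 - ky p.1 p.2) / 2
      - ε * (kx' p.1 p.2 - ky' p.1 p.2) / 2))
    (hρρ : Dec S D 2 (fun p => (kx p.1 p.2 - k₀ - c * w' p.1 p.2)
      - (kx' p.1 p.2 - k₀ - c * v' p.1 p.2)))
    (hxx : Dec S D 0 (fun p => x p.1 p.2 - x' p.1 p.2))
    (hyy : Dec S D 0 (fun p => y p.1 p.2 - y' p.1 p.2))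
    (hend : ControlledAtEnd S D 1
      (fun p => interaction B ε m₀ c V (w p.1) (x p.1) (y p.1) p.2
        - interaction B ε m₀ c V (v p.1) (x' p.1) (y' p.1) p.2)) :
    Dec S D 1 (fun p => x p.1 p.2 - x' p.1 p.2) := by
  have hVn : ∀ p ∈ S, ∀ z, ‖V p.2 z‖ = ‖z‖ := fun p hp => hV.norm_apply p.2 (hS.pos hp)
  have hcw : Dec S D 1 (fun p => c * w p.1 p.2 - c * v p.1 p.2) :=
    ((dec_const c).smul hS hww (l := 1) le_rfl).congr fun p _ => by rw [smul_eq_mul, mul_sub]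
  have h1 := Dec.of_hasDerivAt hS
    (fun p hp => (hasDerivAt_interaction_of_component hε hV (h p.1) (hS.pos hp)).sub
      (hasDerivAt_interaction_of_component hε hV (h' p.1) (hS.pos hp)))
    (dec_rotation_sub hS hVn hcw (dec_normalVel hS.one B ε m₀ hm hρ hx hy) (by simp)
      (dec_normalVel_sub hS B ε m₀ hm hρ hx' hy' hmm hρρ hxx hyy)) hend
  have h2 := dec_sub_of_rotation_sub hS hVn hcw (dec_normalForm hS.one B ε m₀ hx hy) h1
  refine (h2.sub (dec_normalForm_sub_fst hS B ε m₀ hyy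
    (x := fun p => x p.1 p.2 - x' p.1 p.2))).congr fun p _ => ?_
  rw [normalForm_sub]
  abel

end Component

section Pair

variable {K : Type*} [NormedAddCommGroup K] [InnerProductSpace ℂ K] [CompleteSpace K]
variable {ι : Type*} {S S' : Set (ι × ℝ)} {D : ι → ℝ}
  {G : K →L[ℂ] K} {k₁ k₂ Φ : ℝ → ℝ} {E n c c₁ c₂ : ℝ} {x y x' y' : ι → ℝ → K}
  {V₁ V₂ : ℝ → K →L[ℂ] K}

theorem dec_quad (hS : IsDecDomain S D) (hn : n ∈ Set.Icc 0 E) {k : ℝ → ℝ}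
    (hk : HasQuadBound k E n c) (h : ∀ i, IsLZPair G k₁ k₂ E (x i) (y i))
    (hN : Dec S (fun _ => 1) 1 (fun p => ‖x p.1 p.2‖ ^ 2 - n)) :
    Dec S (fun _ => 1) 2 (fun p => k (‖x p.1 p.2‖ ^ 2) - k n - c * (‖x p.1 p.2‖ ^ 2 - n)) := by
  obtain ⟨C, hC⟩ := hk
  refine Dec.of_le_mul hS.one hN hN le_rfl C fun p _ => ?_
  simpa using hC _ ((h p.1).normSq_mem p.2) n hn

theorem dec_quad_sub (hS : IsDecDomain S D) {k : ℝ → ℝ}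
    (hk : HasQuadBound k E n c) (h : ∀ i, IsLZPair G k₁ k₂ E (x i) (y i))
    (h' : ∀ i, IsLZPair G k₁ k₂ E (x' i) (y' i))
    (hN : Dec S (fun _ => 1) 1 (fun p => ‖x p.1 p.2‖ ^ 2 - n))
    (hN' : Dec S (fun _ => 1) 1 (fun p => ‖x' p.1 p.2‖ ^ 2 - n))
    (hNN' : Dec S D 1 (fun p => ‖x p.1 p.2‖ ^ 2 - ‖x' p.1 p.2‖ ^ 2)) :
    Dec S D 2 (fun p => (k (‖x p.1 p.2‖ ^ 2) - k n - c * (‖x p.1 p.2‖ ^ 2 - n))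
      - (k (‖x' p.1 p.2‖ ^ 2) - k n - c * (‖x' p.1 p.2‖ ^ 2 - n))) := by
  obtain ⟨C, hC⟩ := hk
  have h1 : Dec S (fun _ => 1) 1 (fun p => |‖x p.1 p.2‖ ^ 2 - n| + |‖x' p.1 p.2‖ ^ 2 - n|) :=
    (hN.of_le 1 fun p _ => by simp).add (hN'.of_le 1 fun p _ => by simp)
  refine Dec.of_le_mul hS h1 hNN' le_rfl C fun p _ => ?_
  have := hC _ ((h p.1).normSq_mem p.2) _ ((h' p.1).normSq_mem p.2)
  rw [Real.norm_eq_abs, Real.norm_eq_abs, Real.norm_eq_abs, abs_of_nonneg (a := |_| + |_|)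
    (by positivity)]
  convert this using 2
  ring

/-- A priori estimate: solutions that are close to the model at the end of their intervals stay
close to it. -/
theorem dec_pair_model_sub (hS : IsDecDomain S D) (hS' : IsDecDomain S' D) {T : ι → ℝ}
    (hT : ∀ p ∈ S, p.2 ≤ T p.1 ∧ (∀ τ ∈ Set.Icc p.2 (T p.1), (p.1, τ) ∈ S) ∧ (p.1, T p.1) ∈ S')
    (hr : IsLZReg k₁ k₂ Φ E n c₁ c₂)
    (hV₁ : IsModelPhase G 1 (k₁ n) V₁) (hV₂ : IsModelPhase (adjoint G) (-1) (k₂ n) V₂)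
    (h : ∀ i, IsLZPair G k₁ k₂ E (x i) (y i)) (ω₁ ω₂ : K)
    (hω₁ : Dec S' (fun _ => 1) 1 (fun p => V₁ p.2 (x p.1 p.2) - ω₁))
    (hω₂ : Dec S' (fun _ => 1) 1 (fun p => V₂ p.2 (y p.1 p.2) - ω₂))
    (hw : Dec S' (fun _ => 1) 1 (fun p => lzEnergy G Φ n (x p.1) (y p.1) p.2)) :
    Dec S (fun _ => 1) 1 (fun p => V₁ p.2 (x p.1 p.2) - ω₁) ∧
      Dec S (fun _ => 1) 1 (fun p => V₂ p.2 (y p.1 p.2) - ω₂) := by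
  have hwd : Dec S' (fun _ => 1) 2 (fun p => lzEnergy G Φ n (x p.1) (y p.1) p.2 / p.2) :=
    (hw.div_pow hS'.one (i := 1) (l := 2) le_rfl).congr fun p _ => by rw [pow_one]
  have hN := IsLZPair.dec_normSq_sub hS hr h
    (ControlledAtEnd.of_dec hS.one hT (hwd.mono hS'.one (by simp)))
  have hY := (((dec_const (1 / 2 : ℝ)).smul hS'.one (IsLZPair.dec_inner hS' h).im
    le_rfl).div_pow hS'.one (i := 3) (l := 2) (by simp))
  have hE := IsLZPair.dec_lzEnergy hS hr h hN
    (ControlledAtEnd.of_dec hS.one hT ((hwd.sub hY).congr fun p hp => by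
      have := (hS'.pos hp).ne'
      simp only [smul_eq_mul]
      field_simp))
  have hm := IsLZPair.dec_halfDiff hr h hN
  constructor
  · refine dec_model_sub hS (one_pow 2) hV₁ (c := c₁) (m₀ := halfDiff k₁ k₂ n)
      (fun i => (h i).component_fst hr.hasDerivAt) hE ?_ (dec_quad hS hr.mem hr.quad_fst h hN)
      (IsLZPair.dec_fst h) (IsLZPair.dec_snd h) ω₁ (ControlledAtEnd.of_dec hS.one hT
        (((dec_interaction_sub_fst hS' hV₁ (w := fun i => lzEnergy G Φ n (x i) (y i))
          (c := c₁) (m₀ := halfDiff k₁ k₂ n) hw (IsLZPair.dec_fst h) (IsLZPair.dec_snd h)).add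
          hω₁).congr fun p _ => by abel))
    exact hm.congr fun p _ => by simp only [halfDiff]; ring
  · refine dec_model_sub hS (by norm_num) hV₂ (c := c₂) (m₀ := halfDiff k₁ k₂ n)
      (fun i => (h i).component_snd hr.hasDerivAt) hE ?_ (dec_quad hS hr.mem hr.quad_snd h hN)
      (IsLZPair.dec_snd h) (IsLZPair.dec_fst h) ω₂ (ControlledAtEnd.of_dec hS.one hT
        (((dec_interaction_sub_fst hS' hV₂ (w := fun i => lzEnergy G Φ n (x i) (y i))
          (c := c₂) (m₀ := halfDiff k₁ k₂ n) hw (IsLZPair.dec_snd h) (IsLZPair.dec_fst h)).add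
          hω₂).congr fun p _ => by abel))
    exact hm.congr fun p _ => by simp only [halfDiff]; ring

/-- The squared norm of a first-order adiabatic correction. -/
theorem normSq_correction (B : K →L[ℂ] K) (a b : K) (t : ℝ) :
    ‖a - ((1 / (2 * t) : ℝ) : ℂ) • B b‖ ^ 2
      = ‖a‖ ^ 2 - (⟪a, B b⟫_ℂ).re / t + ‖B b‖ ^ 2 / (4 * t ^ 2) := by
  rw [@norm_sub_sq ℂ, inner_smul_right, norm_smul, mul_pow]
  simp only [RCLike.re_eq_complex_re, Complex.re_ofReal_mul, Complex.norm_real, Real.norm_eq_abs,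
    sq_abs]
  ring

/-- The energy of a normalized first-order adiabatic approximation of the model is small. -/
theorem dec_lzEnergy_of_correction (hS : IsDecDomain S D) (hr : IsLZReg k₁ k₂ Φ E n c₁ c₂)
    (h : ∀ i, IsLZPair G k₁ k₂ E (x i) (y i)) {a b : ι × ℝ → K} {l : ι × ℝ → ℝ} {M : ℝ}
    (ha : ∀ p ∈ S, ‖a p‖ ^ 2 = n) (hb : ∀ p ∈ S, ‖b p‖ ≤ M)
    (hl : Dec S (fun _ => 1) 2 (fun p => l p - 1))
    (hx : ∀ p ∈ S, x p.1 p.2 = (l p : ℂ) • (a p - ((1 / (2 * p.2) : ℝ) : ℂ) • G (b p)))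
    (hy : ∀ p ∈ S, y p.1 p.2 = (l p : ℂ) • (b p + ((1 / (2 * p.2) : ℝ) : ℂ) • adjoint G (a p))) :
    Dec S (fun _ => 1) 1 (fun p => x p.1 p.2 - a p) ∧
      Dec S (fun _ => 1) 1 (fun p => y p.1 p.2 - b p) ∧
      Dec S (fun _ => 1) 1 (fun p => lzEnergy G Φ n (x p.1) (y p.1) p.2) := by
  have ha0 : Dec S (fun _ => 1) 0 a := Dec.of_bound (C := Real.sqrt n) fun p hp =>
    Real.le_sqrt_of_sq_le (ha p hp).le
  have hb0 : Dec S (fun _ => 1) 0 b := Dec.of_bound hb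
  have hl0 : Dec S (fun _ => 1) 0 l :=
    ((hl.mono hS.one (by simp)).add (dec_const 1)).congr fun p _ => by ring
  have hi : Dec S (fun _ => 1) 1 (fun p => (1 / (2 * p.2) : ℝ)) :=
    (dec_pow_inv hS.one (1 / 2) 1).congr fun p hp => by
      have := (hS.pos hp).ne'
      field_simp
  have hxa : Dec S (fun _ => 1) 1 (fun p => x p.1 p.2 - a p) := by
    refine ((hl.ofReal.smul hS.one ha0 (l := 1) (by simp)).sub
      ((hl0.smul hS.one hi (l := 1) le_rfl).ofReal.smul hS.one (hb0.clm G)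
        (l := 1) (by simp))).congr fun p hp => ?_
    rw [hx p hp, smul_eq_mul]
    push_cast
    module
  have hyb : Dec S (fun _ => 1) 1 (fun p => y p.1 p.2 - b p) := by
    refine ((hl.ofReal.smul hS.one hb0 (l := 1) (by simp)).add
      ((hl0.smul hS.one hi (l := 1) le_rfl).ofReal.smul hS.one (ha0.clm (adjoint G))
        (l := 1) (by simp))).congr fun p hp => ?_
    rw [hy p hp, smul_eq_mul]
    push_cast
    module
  refine ⟨hxa, hyb, ?_⟩
  have hX := (dec_inner_sub_inner hS.one (IsLZPair.dec_fst h) (hb0.clm G) hxa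
    ((hyb.clm G).congr fun p _ => map_sub _ _ _)).re
  have hq : Dec S (fun _ => 1) 0 (fun p => (⟪a p, G (b p)⟫_ℂ).re) :=
    (Dec.of_le_mul hS.one ha0 (hb0.clm G) le_rfl 1 fun p _ => by
      rw [one_mul]; exact norm_inner_le_norm _ _ :
        Dec S (fun _ => 1) 0 (fun p => ⟪a p, G (b p)⟫_ℂ)).re
  have hGb : Dec S (fun _ => 1) 0 (fun p => ‖G (b p)‖ ^ 2 / 4) :=
    Dec.of_le_mul hS.one (hb0.clm G) (hb0.clm G) le_rfl (1 / 4) fun p _ => by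
      rw [Real.norm_eq_abs, abs_of_nonneg (by positivity)]; apply le_of_eq; ring
  have hz : Dec S (fun _ => 1) 0
      (fun p => n - (⟪a p, G (b p)⟫_ℂ).re / p.2 ^ 1 + ‖G (b p)‖ ^ 2 / 4 / p.2 ^ 2) :=
    ((dec_const n).sub (hq.div_pow hS.one (by simp))).add (hGb.div_pow hS.one (by simp))
  have hl2 : Dec S (fun _ => 1) 2 (fun p => l p ^ 2 - 1) :=
    (((hl0.add (dec_const 1)).smul hS.one hl (l := 2) le_rfl)).congr fun p _ => by
      rw [smul_eq_mul]; ring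
  have hNq : Dec S (fun _ => 1) 2
      (fun p => (‖x p.1 p.2‖ ^ 2 - n) + (⟪a p, G (b p)⟫_ℂ).re / p.2 ^ 1) := by
    refine ((hl2.smul hS.one hz (l := 2) le_rfl).add
      (hGb.div_pow hS.one (i := 2) (l := 2) le_rfl)).congr fun p hp => ?_
    have := (hS.pos hp).ne'
    rw [hx p hp, norm_smul, mul_pow, normSq_correction, ha p hp, Complex.norm_real,
      Real.norm_eq_abs, sq_abs, smul_eq_mul]
    field_simp
    ring
  have hN : Dec S (fun _ => 1) 1 (fun p => ‖x p.1 p.2‖ ^ 2 - n) :=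
    ((hNq.mono hS.one (by simp)).sub (hq.div_pow hS.one (i := 1) (l := 1) le_rfl)).congr
      fun p _ => by ring
  refine (((hNq.mul_id hS.one).add hX).add (IsLZPair.dec_primitive hr h hN)).congr fun p hp => ?_
  have := (hS.pos hp).ne'
  simp only [lzEnergy, Complex.sub_re]
  field_simp
  ring

end Pair

section Uniqueness

variable {K : Type*} [NormedAddCommGroup K] [InnerProductSpace ℂ K] [CompleteSpace K]
variable {ι : Type*} {S : Set (ι × ℝ)} {D : ι → ℝ}
  {G : K →L[ℂ] K} {k₁ k₂ Φ : ℝ → ℝ} {E n c₁ c₂ : ℝ} {x y x' y' : ℝ → K}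
  {V₁ V₂ : ℝ → K →L[ℂ] K}

theorem Dec.tendsto {F : Type*} [NormedAddCommGroup F] {f : ι × ℝ → F} {k : ℕ}
    (hf : Dec S D k f) (hk : k ≠ 0) {p : ι × ℝ} (hp : ∀ t, p.2 ≤ t → (p.1, t) ∈ S) :
    Tendsto (fun t => f (p.1, t)) atTop (𝓝 0) := by
  obtain ⟨C, -, hf⟩ := hf
  refine squeeze_zero_norm' (a := fun t => C * (D p.1 / t ^ k)) ?_ ?_
  · filter_upwards [eventually_ge_atTop p.2] with t ht using hf _ (hp t ht)
  · simpa using (tendsto_const_nhds.div_atTop (tendsto_pow_atTop hk)).const_mul C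

theorem IsLZPair.tendsto_lzEnergy_div (hr : IsLZReg k₁ k₂ Φ E n c₁ c₂)
    (h : IsLZPair G k₁ k₂ E x y) (hN : Tendsto (fun s => ‖x s‖ ^ 2) atTop (𝓝 n)) :
    Tendsto (fun s => lzEnergy G Φ n x y s / s) atTop (𝓝 0) ∧
      Tendsto (fun s => lzEnergy G Φ n x y s / s - (⟪x s, G (y s)⟫_ℂ).im / (2 * s ^ 3))
        atTop (𝓝 0) := by
  have hS : IsDecDomain {p : Unit × ℝ | 1 ≤ p.2} (fun _ => 1) :=
    ⟨fun p hp => hp, fun _ _ => zero_le_one⟩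
  have hh : ∀ _ : Unit, IsLZPair G k₁ k₂ E x y := fun _ => h
  have hup : ∀ t, ((), (1 : ℝ)).2 ≤ t → (((), (1 : ℝ)).1, t) ∈ {p : Unit × ℝ | 1 ≤ p.2} :=
    fun t ht => ht
  have hi := IsLZPair.dec_inner hS hh
  have h1 := (((IsLZPair.dec_primitive hr hh (IsLZPair.dec_normSq_sub_zero hS hh)).add
    hi.re).div_pow hS (i := 1) (l := 1) (by simp)).tendsto one_ne_zero hup
  have h2 := (((dec_const (1 / 2 : ℝ)).smul hS hi.im le_rfl).div_pow hS
    (i := 3) (l := 1) (by simp)).tendsto one_ne_zero hup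
  have h3 : Tendsto (fun s => lzEnergy G Φ n x y s / s) atTop (𝓝 0) := by
    have h4 := (hN.sub_const n).add h1
    rw [sub_self, add_zero] at h4
    refine h4.congr' ?_
    filter_upwards [eventually_gt_atTop 0] with s hs
    simp only [lzEnergy]
    field_simp
    ring
  refine ⟨h3, ?_⟩
  have h5 := h3.sub h2
  rw [sub_zero] at h5
  refine h5.congr' ?_
  filter_upwards [eventually_gt_atTop 0] with s hs
  simp only [smul_eq_mul]
  field_simp

theorem tendsto_interaction_sub {B : K →L[ℂ] K} {ε k₀ m₀ c : ℝ} {V : ℝ → K →L[ℂ] K}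
    {w v : ℝ → ℝ} (hV : IsModelPhase B ε k₀ V)
    (h : Tendsto (fun s => interaction B ε m₀ c V w x y s - V s (x s)) atTop (𝓝 0))
    (h' : Tendsto (fun s => interaction B ε m₀ c V v x' y' s - V s (x' s)) atTop (𝓝 0))
    (hx : Tendsto (fun s => x s - x' s) atTop (𝓝 0)) :
    Tendsto (fun s => interaction B ε m₀ c V w x y s - interaction B ε m₀ c V v x' y' s)
      atTop (𝓝 0) := by
  have hVx : Tendsto (fun s => V s (x s - x' s)) atTop (𝓝 0) := by
    rw [tendsto_zero_iff_norm_tendsto_zero] at hx ⊢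
    refine hx.congr' ?_
    filter_upwards [eventually_gt_atTop 0] with s hs using (hV.norm_apply s hs _).symm
  have := (h.sub h').add hVx
  rw [sub_zero, add_zero] at this
  refine this.congr fun s => ?_
  rw [map_sub]
  abel

set_option maxHeartbeats 800000 in
/-- Two solutions with the same asymptotics which are `d`-close on a half-line `[S₀, ∞)` are
`C d / s`-close there. -/
theorem IsLZPair.exists_norm_sub_le (hr : IsLZReg k₁ k₂ Φ E n c₁ c₂)
    (hV₁ : IsModelPhase G 1 (k₁ n) V₁) (hV₂ : IsModelPhase (adjoint G) (-1) (k₂ n) V₂)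
    (h : IsLZPair G k₁ k₂ E x y) (h' : IsLZPair G k₁ k₂ E x' y')
    (hN : Tendsto (fun s => ‖x s‖ ^ 2) atTop (𝓝 n))
    (hN' : Tendsto (fun s => ‖x' s‖ ^ 2) atTop (𝓝 n))
    (hx : Tendsto (fun s => x s - x' s) atTop (𝓝 0))
    (hy : Tendsto (fun s => y s - y' s) atTop (𝓝 0)) :
    ∃ C, 0 ≤ C ∧ ∀ S₀ d, 1 ≤ S₀ → (∀ s, S₀ ≤ s → ‖x s - x' s‖ ≤ d ∧ ‖y s - y' s‖ ≤ d) →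
      ∀ s, S₀ ≤ s → ‖x s - x' s‖ ≤ C * (d / s) ∧ ‖y s - y' s‖ ≤ C * (d / s) := by
  set S : Set ((ℝ × ℝ) × ℝ) := {p | 1 ≤ p.1.1 ∧ p.1.1 ≤ p.2 ∧
    ∀ s, p.1.1 ≤ s → ‖x s - x' s‖ ≤ p.1.2 ∧ ‖y s - y' s‖ ≤ p.1.2} with hSdef
  have hS : IsDecDomain S (fun i => i.2) :=
    ⟨fun p hp => hp.1.trans hp.2.1, fun p hp => (norm_nonneg _).trans (hp.2.2 _ le_rfl).1⟩
  have hup : ∀ p ∈ S, ∀ t, p.2 ≤ t → (p.1, t) ∈ S :=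
    fun p hp t ht => ⟨hp.1, hp.2.1.trans ht, hp.2.2⟩
  have hh : ∀ _ : ℝ × ℝ, IsLZPair G k₁ k₂ E x y := fun _ => h
  have hh' : ∀ _ : ℝ × ℝ, IsLZPair G k₁ k₂ E x' y' := fun _ => h'
  have hxx : Dec S (fun i => i.2) 0 (fun p => x p.2 - x' p.2) :=
    ⟨1, zero_le_one, fun p hp => by simpa using (hp.2.2 p.2 hp.2.1).1⟩
  have hyy : Dec S (fun i => i.2) 0 (fun p => y p.2 - y' p.2) :=
    ⟨1, zero_le_one, fun p hp => by simpa using (hp.2.2 p.2 hp.2.1).2⟩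
  obtain ⟨e1, e2⟩ := h.tendsto_lzEnergy_div hr hN
  obtain ⟨e1', e2'⟩ := h'.tendsto_lzEnergy_div hr hN'
  have dN := IsLZPair.dec_normSq_sub hS hr hh (.of_tendsto hup fun _ _ => e1)
  have dN' := IsLZPair.dec_normSq_sub hS hr hh' (.of_tendsto hup fun _ _ => e1')
  have dE := IsLZPair.dec_lzEnergy hS hr hh dN (.of_tendsto hup fun _ _ => e2)
  have dE' := IsLZPair.dec_lzEnergy hS hr hh' dN' (.of_tendsto hup fun _ _ => e2')
  have dNN := IsLZPair.dec_normSq_sub_normSq' hS hr hh hh' hxx hyy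
    (.of_tendsto hup fun _ _ => by simpa using e1.sub e1')
  have dEE := IsLZPair.dec_lzEnergy_sub hS hr hh hh' hxx hyy dNN
    (.of_tendsto hup fun _ _ => by simpa using e2.sub e2')
  have hm := IsLZPair.dec_halfDiff hr hh dN
  have hmm := IsLZPair.dec_halfDiff_sub hr hh hh' dNN
  have bx := IsLZPair.dec_fst (S := S) hh
  have bx' := IsLZPair.dec_fst (S := S) hh'
  have bY := IsLZPair.dec_snd (S := S) hh
  have bY' := IsLZPair.dec_snd (S := S) hh'
  have q₁ := dec_quad_sub hS hr.quad_fst hh hh' dN dN' dNN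
  have q₂ := dec_quad_sub hS hr.quad_snd hh hh' dN dN' dNN
  obtain ⟨C₁, hC₁, h1⟩ : Dec S (fun i => i.2) 1 (fun p => x p.2 - x' p.2) := by
    refine dec_fst_sub hS (one_pow 2) hV₁ (c := c₁) (m₀ := halfDiff k₁ k₂ n)
      (fun i => (hh i).component_fst hr.hasDerivAt) (fun i => (hh' i).component_fst hr.hasDerivAt)
      (hm.congr fun p _ => by simp only [halfDiff]; ring)
      (dec_quad hS hr.mem hr.quad_fst hh dN) bx bY bx' bY' dEE
      (hmm.congr fun p _ => by simp only [halfDiff]; ring)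
      q₁ hxx hyy
      (.of_tendsto hup fun p hp => tendsto_interaction_sub hV₁ ?_ ?_ hx)
    · exact (dec_interaction_sub_fst (x := fun _ => x) (y := fun _ => y)
        (w := fun _ => lzEnergy G Φ n x y) hS hV₁ dE bx bY).tendsto one_ne_zero (hup p hp)
    · exact (dec_interaction_sub_fst (x := fun _ => x') (y := fun _ => y')
        (w := fun _ => lzEnergy G Φ n x' y') hS hV₁ dE' bx' bY').tendsto one_ne_zero (hup p hp)
  obtain ⟨C₂, hC₂, h2⟩ : Dec S (fun i => i.2) 1 (fun p => y p.2 - y' p.2) := by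
    refine dec_fst_sub hS (by norm_num) hV₂ (c := c₂) (m₀ := halfDiff k₁ k₂ n)
      (fun i => (hh i).component_snd hr.hasDerivAt) (fun i => (hh' i).component_snd hr.hasDerivAt)
      (hm.congr fun p _ => by simp only [halfDiff]; ring)
      (dec_quad hS hr.mem hr.quad_snd hh dN) bY bx bY' bx' dEE
      (hmm.congr fun p _ => by simp only [halfDiff]; ring)
      q₂ hyy hxx
      (.of_tendsto hup fun p hp => tendsto_interaction_sub hV₂ ?_ ?_ hy)
    · exact (dec_interaction_sub_fst (x := fun _ => y) (y := fun _ => x)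
        (w := fun _ => lzEnergy G Φ n x y) hS hV₂ dE bY bx).tendsto one_ne_zero (hup p hp)
    · exact (dec_interaction_sub_fst (x := fun _ => y') (y := fun _ => x')
        (w := fun _ => lzEnergy G Φ n x' y') hS hV₂ dE' bY' bx').tendsto one_ne_zero (hup p hp)
  refine ⟨C₁ + C₂, by positivity, fun S₀ d hS₀ hd s hs => ?_⟩
  have hp : ((S₀, d), s) ∈ S := ⟨hS₀, hs, hd⟩
  have hd0 : 0 ≤ d / s ^ 1 :=
    div_nonneg ((norm_nonneg _).trans (hd _ le_rfl).1) (pow_nonneg (by linarith) 1)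
  have h1 := h1 _ hp
  have h2 := h2 _ hp
  dsimp only at h1 h2
  rw [pow_one] at h1 h2 hd0
  constructor <;> nlinarith [mul_nonneg hC₁ hd0, mul_nonneg hC₂ hd0]

/-- Two solutions with the same asymptotics agree near `+∞`. -/
theorem IsLZPair.exists_forall_eq (hr : IsLZReg k₁ k₂ Φ E n c₁ c₂)
    (hV₁ : IsModelPhase G 1 (k₁ n) V₁) (hV₂ : IsModelPhase (adjoint G) (-1) (k₂ n) V₂)
    (h : IsLZPair G k₁ k₂ E x y) (h' : IsLZPair G k₁ k₂ E x' y')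
    (hN : Tendsto (fun s => ‖x s‖ ^ 2) atTop (𝓝 n))
    (hN' : Tendsto (fun s => ‖x' s‖ ^ 2) atTop (𝓝 n))
    (hx : Tendsto (fun s => x s - x' s) atTop (𝓝 0))
    (hy : Tendsto (fun s => y s - y' s) atTop (𝓝 0)) :
    ∃ s, x s = x' s ∧ y s = y' s := by
  obtain ⟨C, hC, hCs⟩ := IsLZPair.exists_norm_sub_le hr hV₁ hV₂ h h' hN hN' hx hy
  have hev := (((tendsto_zero_iff_norm_tendsto_zero.1 hx).eventually
    (ge_mem_nhds zero_lt_one)).and ((tendsto_zero_iff_norm_tendsto_zero.1 hy).eventually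
    (ge_mem_nhds zero_lt_one)))
  obtain ⟨S₁, hS₁⟩ := eventually_atTop.1 hev
  set S₀ := max S₁ (1 + 2 * C) with hS₀
  have hS₀1 : 1 + 2 * C ≤ S₀ := le_max_right _ _
  have key : ∀ j : ℕ, ∀ s, S₀ ≤ s → ‖x s - x' s‖ ≤ (1 / 2) ^ j ∧ ‖y s - y' s‖ ≤ (1 / 2) ^ j := by
    intro j
    induction j with
    | zero => exact fun s hs => by simpa using hS₁ s ((le_max_left _ _).trans hs)
    | succ j ih =>
      intro s hs
      have h1 := hCs S₀ _ (by linarith) ih s hs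
      have h2 : C * ((1 / 2) ^ j / s) ≤ (1 / 2) ^ (j + 1) := by
        have hs0 : 0 < s := by linarith
        rw [← mul_div_assoc, div_le_iff₀ hs0, pow_succ]
        have : (0 : ℝ) < (1 / 2) ^ j := by positivity
        nlinarith
      exact ⟨h1.1.trans h2, h1.2.trans h2⟩
  have hlim : Tendsto (fun j : ℕ => (1 / 2 : ℝ) ^ j) atTop (𝓝 0) :=
    tendsto_pow_atTop_nhds_zero_of_lt_one (by norm_num) (by norm_num)
  refine ⟨S₀, ?_, ?_⟩
  · exact sub_eq_zero.1 (norm_le_zero_iff.1 (ge_of_tendsto' hlim fun j => (key j S₀ le_rfl).1))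
  · exact sub_eq_zero.1 (norm_le_zero_iff.1 (ge_of_tendsto' hlim fun j => (key j S₀ le_rfl).2))

end Uniqueness

section Regularity

theorem hasQuadBound_of_contDiff {k : ℝ → ℝ} (hk : ContDiff ℝ 2 k) {E n : ℝ}
    (hn : n ∈ Set.Icc 0 E) : HasQuadBound k E n (deriv k n) := by
  have hd : ContDiff ℝ 1 (deriv k) := by
    have : ContDiff ℝ (1 + 1) k := by simpa [one_add_one_eq_two] using hk
    exact (contDiff_succ_iff_deriv.1 this).2.2
  obtain ⟨C, hC⟩ := (isCompact_Icc (a := (0 : ℝ)) (b := E)).exists_bound_of_continuousOn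
    (hd.continuous_deriv le_rfl).continuousOn
  have hC0 : 0 ≤ C := (norm_nonneg _).trans (hC n hn)
  have hL : ∀ t ∈ Set.Icc 0 E, |deriv k t - deriv k n| ≤ C * |t - n| := fun t ht =>
    (convex_Icc 0 E).norm_image_sub_le_of_norm_deriv_le
      (fun x _ => (hd.differentiable one_ne_zero).differentiableAt) hC hn ht
  refine ⟨C, fun a ha b hb => ?_⟩
  have h1 := (convex_uIcc b a).norm_image_sub_le_of_norm_hasDerivWithin_le
    (f := fun t => k t - deriv k n * t) (f' := fun t => deriv k t - deriv k n)
    (C := C * (|a - n| + |b - n|)) (fun t _ => HasDerivAt.hasDerivWithinAt ?_) (fun t ht => ?_)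
    Set.left_mem_uIcc Set.right_mem_uIcc
  · rw [Real.norm_eq_abs, Real.norm_eq_abs] at h1
    rw [← mul_assoc]
    convert h1 using 2
    ring
  · exact HasDerivAt.congr_deriv ((hk.differentiable two_ne_zero t).hasDerivAt.sub
      ((hasDerivAt_id t).const_mul (deriv k n))) (by simp)
  · refine (hL t (Set.uIcc_subset_Icc hb ha ht)).trans (mul_le_mul_of_nonneg_left ?_ hC0)
    rcases Set.mem_uIcc.1 ht with h | h <;> rw [abs_le] <;> constructor <;>
      linarith [neg_abs_le (a - n), neg_abs_le (b - n), le_abs_self (a - n), le_abs_self (b - n),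
        abs_nonneg (a - n), abs_nonneg (b - n)]

theorem exists_isLZReg {k₁ k₂ : ℝ → ℝ} (hk₁ : ContDiff ℝ 2 k₁) (hk₂ : ContDiff ℝ 2 k₂) {E n : ℝ}
    (hn : n ∈ Set.Icc 0 E) : ∃ Φ, IsLZReg k₁ k₂ Φ E n (deriv k₁ n) (deriv k₂ n) := by
  have hc : Continuous (halfDiff k₁ k₂) := (hk₁.continuous.sub hk₂.continuous).div_const 2
  exact ⟨fun a => ∫ t in n..a, halfDiff k₁ k₂ t, hn, hasQuadBound_of_contDiff hk₁ hn,
    hasQuadBound_of_contDiff hk₂ hn, fun a => hc.integral_hasStrictDerivAt n a |>.hasDerivAt,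
    intervalIntegral.integral_same⟩

end Regularity

section Phase

variable {K : Type*} [NormedAddCommGroup K] [InnerProductSpace ℂ K] [CompleteSpace K]

theorem fc_exp_affine {A : K →L[ℂ] K} (hA : IsSelfAdjoint A) (a b : ℝ) :
    fc (fun x : ℝ => Complex.exp (I * ((a + b * x : ℝ) : ℂ))) A
      = Complex.exp (I * a) • NormedSpace.exp ((I * b) • A) := by
  have hn : IsStarNormal A := hA.isStarNormal
  rw [fc, cfc_real_eq_complex, cfc_real_eq_complex, ← cfc_const_mul .., ← cfc_add ..,
    ← CFC.complex_exp_eq_normedSpace_exp (hn.smul _), ← cfc_comp_smul .., ← cfc_const_mul ..]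
  refine cfc_congr fun z hz => ?_
  have hz' : ((z.re : ℝ) : ℂ) = z := (SpectrumRestricts.real_iff.mp hA.spectrumRestricts z hz).symm
  rw [mul_comm I (_ : ℂ), mul_comm I ((Complex.exp _).im : ℂ), Complex.re_add_im, ← hz',
    ← Complex.exp_add]
  push_cast
  simp
  ring_nf

/-- The propagator of the diagonal model flow. -/
def modelPhase (B : K →L[ℂ] K) (ε k₀ s : ℝ) : K →L[ℂ] K :=
  Complex.exp (I * ((-(k₀ * s + ε * (s ^ 2 / 2)) : ℝ) : ℂ))
    • NormedSpace.exp ((I * ((-(ε * (Real.log s / 2)) : ℝ) : ℂ)) • (B * adjoint B))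

theorem isSelfAdjoint_mul_adjoint (B : K →L[ℂ] K) : IsSelfAdjoint (B * adjoint B) := by
  rw [← star_eq_adjoint]
  exact IsSelfAdjoint.mul_star_self B

theorem isModelPhase_modelPhase (B : K →L[ℂ] K) (ε k₀ : ℝ) :
    IsModelPhase B ε k₀ (modelPhase B ε k₀) where
  norm_apply s _ z := by
    have h1 : (I * ((-(ε * (Real.log s / 2)) : ℝ) : ℂ)) • (B * adjoint B)
        ∈ skewAdjoint (K →L[ℂ] K) := by
      refine (isSelfAdjoint_mul_adjoint B).smul_mem_skewAdjoint ?_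
      rw [skewAdjoint.mem_iff]
      simp
    let +nondep : NormedAlgebra ℚ (K →L[ℂ] K) := .restrictScalars ℚ ℂ (K →L[ℂ] K)
    have h2 := NormedSpace.exp_mem_unitary_of_mem_skewAdjoint h1
    rw [modelPhase, smul_apply, norm_smul, mul_comm I, Complex.norm_exp_ofReal_mul_I,
      one_mul]
    exact ContinuousLinearMap.norm_map_of_mem_unitary h2 z
  hasDerivAt s hs := by
    have h1 : HasDerivAt (fun t : ℝ => I * ((-(ε * (Real.log t / 2)) : ℝ) : ℂ))
        (I * ((-(ε * (s⁻¹ / 2)) : ℝ) : ℂ)) s :=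
      ((((Real.hasDerivAt_log hs.ne').div_const 2).const_mul ε).neg.ofReal_comp).const_mul I
    have h2 := (hasDerivAt_exp_smul_const (𝕂 := ℂ) (B * adjoint B)
      (I * ((-(ε * (Real.log s / 2)) : ℝ) : ℂ))).scomp s h1
    have h3 : HasDerivAt (fun t : ℝ => Complex.exp (I * ((-(k₀ * t + ε * (t ^ 2 / 2)) : ℝ) : ℂ)))
        (Complex.exp (I * ((-(k₀ * s + ε * (s ^ 2 / 2)) : ℝ) : ℂ))
          * (I * ((-(k₀ + ε * s) : ℝ) : ℂ))) s := by
      refine HasDerivAt.cexp (HasDerivAt.const_mul I (HasDerivAt.ofReal_comp ?_))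
      refine HasDerivAt.congr_deriv ((((hasDerivAt_id s).const_mul k₀).add
        (((hasDerivAt_pow 2 s).div_const 2).const_mul ε)).neg) ?_
      simp
    refine HasDerivAt.congr_deriv (h3.smul h2) ?_
    simp only [modelPhase, smul_mul_assoc]
    have : s ≠ 0 := hs.ne'
    rw [show ε / (2 * s) = ε * (s⁻¹ / 2) by field_simp]
    push_cast
    module

theorem modelPhase_apply_fc (B : K →L[ℂ] K) (ε k₀ : ℝ) {s : ℝ} (hs : 0 < s) (z : K) :
    modelPhase B ε k₀ s (Complex.exp (I * ((k₀ * s : ℝ) : ℂ)) •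
      fc (fun x : ℝ => Complex.exp (I * ((ε * phase s x : ℝ) : ℂ))) (B * adjoint B) z) = z := by
  have h1 : (fun x : ℝ => Complex.exp (I * ((ε * phase s x : ℝ) : ℂ)))
      = fun x : ℝ => Complex.exp
        (I * ((ε * (s ^ 2 / 2) + (ε * (Real.log s / 2)) * x : ℝ) : ℂ)) := by
    funext x
    rw [phase, abs_of_pos hs]
    ring_nf
  rw [h1, fc_exp_affine (isSelfAdjoint_mul_adjoint B), modelPhase]
  set X := (I * ((ε * (Real.log s / 2) : ℝ) : ℂ)) • (B * adjoint B) with hX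
  have h2 : (I * ((-(ε * (Real.log s / 2)) : ℝ) : ℂ)) • (B * adjoint B) = -X := by
    rw [hX]; push_cast; module
  have h3 : NormedSpace.exp (-X) * NormedSpace.exp X = 1 := by
    let +nondep : NormedAlgebra ℚ (K →L[ℂ] K) := .restrictScalars ℚ ℂ (K →L[ℂ] K)
    have : NormedSpace.exp (-X + X) = NormedSpace.exp (-X) * NormedSpace.exp X :=
      NormedSpace.exp_add_of_commute ((Commute.refl X).neg_left)
    rw [← this]
    simp
  rw [h2]
  simp only [smul_apply, map_smul, smul_smul, ← Complex.exp_add]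
  rw [← mul_apply_eq_comp, h3, one_apply_eq_self]
  convert one_smul ℂ z
  rw [← Complex.exp_zero]
  congr 1
  push_cast
  ring

end Phase

section Field

variable {K : Type*} [NormedAddCommGroup K] [InnerProductSpace ℂ K] [CompleteSpace K]

/-- The time-dependent vector field of the nonlinear Landau–Zener system. -/
def lzField (G : K →L[ℂ] K) (δ : ℝ) (f₁ f₂ : ℝ × ℝ → ℝ) (s : ℝ) (x : WithLp 2 (K × K)) :
    WithLp 2 (K × K) :=
  I • (Vop G s x + δ • nlt f₁ f₂ x)

variable (G : K →L[ℂ] K) (δ : ℝ) (f₁ f₂ : ℝ × ℝ → ℝ)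

theorem lzField_fst (s : ℝ) (x : WithLp 2 (K × K)) :
    (lzField G δ f₁ f₂ s x).fst = I • (((s + δ * F1 f₁ x : ℝ) : ℂ) • x.fst + G x.snd) := by
  have h1 : (Vop G s x).fst = (s : ℂ) • x.fst + G x.snd := rfl
  have h2 : (δ • nlt f₁ f₂ x).fst = δ • F1 f₁ x • x.fst := rfl
  have h3 : (lzField G δ f₁ f₂ s x).fst = I • ((Vop G s x).fst + (δ • nlt f₁ f₂ x).fst) := rfl
  rw [h3, h1, h2, smul_smul, ← Complex.coe_smul, Complex.ofReal_add]
  module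

theorem lzField_snd (s : ℝ) (x : WithLp 2 (K × K)) :
    (lzField G δ f₁ f₂ s x).snd
      = I • (adjoint G x.fst + ((-s + δ * F2 f₂ x : ℝ) : ℂ) • x.snd) := by
  have h1 : (Vop G s x).snd = adjoint G x.fst - (s : ℂ) • x.snd := rfl
  have h2 : (δ • nlt f₁ f₂ x).snd = δ • F2 f₂ x • x.snd := rfl
  have h3 : (lzField G δ f₁ f₂ s x).snd = I • ((Vop G s x).snd + (δ • nlt f₁ f₂ x).snd) := rfl
  rw [h3, h1, h2, smul_smul, ← Complex.coe_smul, Complex.ofReal_add, Complex.ofReal_neg]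
  module

theorem re_inner_lzField (s : ℝ) (x : WithLp 2 (K × K)) :
    (⟪x, lzField G δ f₁ f₂ s x⟫_ℂ).re = 0 := by
  have h : ⟪x, lzField G δ f₁ f₂ s x⟫_ℂ = ⟪x.fst, (lzField G δ f₁ f₂ s x).fst⟫_ℂ
      + ⟪x.snd, (lzField G δ f₁ f₂ s x).snd⟫_ℂ := WithLp.prod_inner_apply _ _
  have hG : ⟪x.snd, adjoint G x.fst⟫_ℂ = (starRingEnd ℂ) ⟪x.fst, G x.snd⟫_ℂ := by
    rw [adjoint_inner_right, inner_conj_symm]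
  rw [h, lzField_fst, lzField_snd]
  simp only [inner_smul_right, inner_add_right, hG, inner_self_eq_norm_sq_to_K]
  simp only [Complex.coe_algebraMap, ← Complex.ofReal_pow, Complex.add_re, Complex.mul_re,
    Complex.mul_im, Complex.I_re, Complex.I_im, Complex.add_im, Complex.ofReal_re,
    Complex.ofReal_im, Complex.conj_im, Complex.conj_re]
  ring

variable {f₁ f₂}

theorem contDiff_lzField (hf₁ : ContDiff ℝ 1 f₁) (hf₂ : ContDiff ℝ 1 f₂) :
    ContDiff ℝ 1 (fun p : ℝ × WithLp 2 (K × K) => lzField G δ f₁ f₂ p.1 p.2) := by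
  have hfst : ContDiff ℝ 1 (fun p : ℝ × WithLp 2 (K × K) => p.2.fst) :=
    (WithLp.fstL 2 ℝ K K).contDiff.comp contDiff_snd
  have hsnd : ContDiff ℝ 1 (fun p : ℝ × WithLp 2 (K × K) => p.2.snd) :=
    (WithLp.sndL 2 ℝ K K).contDiff.comp contDiff_snd
  have hG : ∀ B : K →L[ℂ] K, ContDiff ℝ 1 B := fun B => (B.restrictScalars ℝ).contDiff
  have hn := (hfst.norm_sq ℂ).prodMk (hsnd.norm_sq ℂ)
  have hF1 : ContDiff ℝ 1 (fun p : ℝ × WithLp 2 (K × K) => F1 f₁ p.2) := hf₁.comp hn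
  have hF2 : ContDiff ℝ 1 (fun p : ℝ × WithLp 2 (K × K) => F2 f₂ p.2) := hf₂.comp hn
  have hs : ContDiff ℝ 1 (fun p : ℝ × WithLp 2 (K × K) => p.1) := contDiff_fst
  have h1 : ContDiff ℝ 1 (fun p : ℝ × WithLp 2 (K × K) => (lzField G δ f₁ f₂ p.1 p.2).fst) := by
    simp_rw [lzField_fst, Complex.coe_smul]
    exact (((hs.add (contDiff_const.mul hF1)).smul hfst).add ((hG G).comp hsnd)).const_smul I
  have h2 : ContDiff ℝ 1 (fun p : ℝ × WithLp 2 (K × K) => (lzField G δ f₁ f₂ p.1 p.2).snd) := by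
    simp_rw [lzField_snd, Complex.coe_smul]
    exact (((hG (adjoint G)).comp hfst).add
      ((hs.neg.add (contDiff_const.mul hF2)).smul hsnd)).const_smul I
  exact (WithLp.prodContinuousLinearEquiv 2 ℝ K K).symm.contDiff.comp (h1.prodMk h2)

variable {G δ}

theorem IsLZSol.norm_eq {u : ℝ → WithLp 2 (K × K)} (hu : IsLZSol G δ f₁ f₂ u) (s t : ℝ) :
    ‖u s‖ = ‖u t‖ :=
  norm_eq_of_hasDerivAt_orthogonal isOpen_univ isPreconnected_univ
    (re_inner_lzField G δ f₁ f₂) (fun t _ => hu t) (Set.mem_univ s) (Set.mem_univ t)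

theorem IsLZSol.isLZPair {u : ℝ → WithLp 2 (K × K)} {E : ℝ} (hu : IsLZSol G δ f₁ f₂ u)
    (hE : ∀ s, ‖u s‖ ^ 2 = E) :
    IsLZPair G (fun a => δ * f₁ (a, E - a)) (fun a => δ * f₂ (a, E - a)) E
      (fun s => (u s).fst) (fun s => (u s).snd) where
  deriv_fst s := by
    have h := ((WithLp.fstL 2 ℝ K K).hasFDerivAt (x := u s)).comp_hasDerivAt s (hu s)
    refine HasDerivAt.congr_deriv h ((lzField_fst G δ f₁ f₂ s (u s)).trans ?_)
    rw [F1, show ‖(u s).snd‖ ^ 2 = E - ‖(u s).fst‖ ^ 2 by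
      rw [← hE s, WithLp.prod_norm_sq_eq_of_L2]; ring]
  deriv_snd s := by
    have h := ((WithLp.sndL 2 ℝ K K).hasFDerivAt (x := u s)).comp_hasDerivAt s (hu s)
    refine HasDerivAt.congr_deriv h ((lzField_snd G δ f₁ f₂ s (u s)).trans ?_)
    rw [F2, show ‖(u s).snd‖ ^ 2 = E - ‖(u s).fst‖ ^ 2 by
      rw [← hE s, WithLp.prod_norm_sq_eq_of_L2]; ring]
  normSq_add s := by rw [← hE s, WithLp.prod_norm_sq_eq_of_L2]

theorem contDiff_slice {f : ℝ × ℝ → ℝ} (hf : ContDiff ℝ 2 f) (δ E : ℝ) :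
    ContDiff ℝ 2 (fun a => δ * f (a, E - a)) :=
  contDiff_const.mul (hf.comp (contDiff_id.prodMk (contDiff_const.sub contDiff_id)))

end Field

section Asymptotics

variable {K : Type*} [NormedAddCommGroup K] [InnerProductSpace ℂ K] [CompleteSpace K]
variable {G : K →L[ℂ] K} {δ : ℝ} {f₁ f₂ : ℝ × ℝ → ℝ} {ω : WithLp 2 (K × K)} {s : ℝ}

theorem modelPhase_asym1 (hs : 0 < s) :
    modelPhase G 1 (δ * F1 f₁ ω) s (asym1 G δ f₁ ω 0 s) = ω.fst := by
  have h := modelPhase_apply_fc G 1 (δ * F1 f₁ ω) hs ω.fst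
  have e : I * ((δ * F1 f₁ ω * s : ℝ) : ℂ) = I * (δ * F1 f₁ ω * s + (0 : ℝ)) := by
    push_cast
    ring
  rw [e] at h
  rw [asym1, ePhaseP]
  simpa only [one_mul] using h

theorem modelPhase_asym2 (hs : 0 < s) :
    modelPhase (adjoint G) (-1) (δ * F2 f₂ ω) s (asym2 G δ f₂ ω 0 s) = ω.snd := by
  have h := modelPhase_apply_fc (adjoint G) (-1) (δ * F2 f₂ ω) hs ω.snd
  have e : I * ((δ * F2 f₂ ω * s : ℝ) : ℂ) = I * (δ * F2 f₂ ω * s - (0 : ℝ)) := by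
    push_cast
    ring
  rw [e, adjoint_adjoint] at h
  rw [asym2, ePhaseM]
  simpa only [neg_mul, one_mul, Complex.ofReal_neg, mul_neg] using h

theorem norm_asym1 (hs : 0 < s) (ϕ : ℝ) : ‖asym1 G δ f₁ ω ϕ s‖ = ‖ω.fst‖ := by
  have h : asym1 G δ f₁ ω ϕ s = Complex.exp (ϕ * I) • asym1 G δ f₁ ω 0 s := by
    rw [asym1, asym1, smul_smul, ← Complex.exp_add]
    congr 2
    push_cast
    ring
  rw [h, norm_smul, Complex.norm_exp_ofReal_mul_I, one_mul, ← modelPhase_asym1 (ω := ω) hs,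
    (isModelPhase_modelPhase G 1 (δ * F1 f₁ ω)).norm_apply s hs]

theorem norm_asym2 (hs : 0 < s) (ϕ : ℝ) : ‖asym2 G δ f₂ ω ϕ s‖ = ‖ω.snd‖ := by
  have h : asym2 G δ f₂ ω ϕ s = Complex.exp ((-ϕ : ℝ) * I) • asym2 G δ f₂ ω 0 s := by
    rw [asym2, asym2, smul_smul, ← Complex.exp_add]
    congr 2
    push_cast
    ring
  rw [h, norm_smul, Complex.norm_exp_ofReal_mul_I, one_mul, ← modelPhase_asym2 (ω := ω) hs,
    (isModelPhase_modelPhase (adjoint G) (-1) (δ * F2 f₂ ω)).norm_apply s hs]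

theorem norm_modelPhase_sub_fst (hs : 0 < s) (x : K) :
    ‖modelPhase G 1 (δ * F1 f₁ ω) s x - ω.fst‖ = ‖x - asym1 G δ f₁ ω 0 s‖ := by
  rw [← modelPhase_asym1 (G := G) (δ := δ) (f₁ := f₁) hs, ← map_sub]
  exact (isModelPhase_modelPhase G 1 (δ * F1 f₁ ω)).norm_apply s hs _

theorem norm_modelPhase_sub_snd (hs : 0 < s) (y : K) :
    ‖modelPhase (adjoint G) (-1) (δ * F2 f₂ ω) s y - ω.snd‖ = ‖y - asym2 G δ f₂ ω 0 s‖ := by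
  rw [← modelPhase_asym2 (G := G) (δ := δ) (f₂ := f₂) hs, ← map_sub]
  exact (isModelPhase_modelPhase (adjoint G) (-1) (δ * F2 f₂ ω)).norm_apply s hs _

theorem mul_F1_eq (δ : ℝ) (f₁ : ℝ × ℝ → ℝ) (ω : WithLp 2 (K × K)) :
    δ * F1 f₁ ω = δ * f₁ (‖ω.fst‖ ^ 2, ‖ω‖ ^ 2 - ‖ω.fst‖ ^ 2) := by
  rw [F1, WithLp.prod_norm_sq_eq_of_L2, add_sub_cancel_left]

theorem mul_F2_eq (δ : ℝ) (f₂ : ℝ × ℝ → ℝ) (ω : WithLp 2 (K × K)) :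
    δ * F2 f₂ ω = δ * f₂ (‖ω.fst‖ ^ 2, ‖ω‖ ^ 2 - ‖ω.fst‖ ^ 2) := by
  rw [F2, WithLp.prod_norm_sq_eq_of_L2, add_sub_cancel_left]

theorem normSq_fst_mem (ω : WithLp 2 (K × K)) : ‖ω.fst‖ ^ 2 ∈ Set.Icc 0 (‖ω‖ ^ 2) :=
  ⟨by positivity, by rw [WithLp.prod_norm_sq_eq_of_L2]; nlinarith [sq_nonneg ‖ω.snd‖]⟩

variable {ϕ : ℝ} {u u' : ℝ → WithLp 2 (K × K)}

theorem Outgoing.tendsto_fst (h : Outgoing G δ f₁ f₂ ω ϕ u) :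
    Tendsto (fun s => (u s).fst - asym1 G δ f₁ ω ϕ s) atTop (𝓝 0) :=
  squeeze_zero_norm (fun _ => le_add_of_nonneg_right (norm_nonneg _)) h

theorem Outgoing.tendsto_snd (h : Outgoing G δ f₁ f₂ ω ϕ u) :
    Tendsto (fun s => (u s).snd - asym2 G δ f₂ ω ϕ s) atTop (𝓝 0) :=
  squeeze_zero_norm (fun _ => le_add_of_nonneg_left (norm_nonneg _)) h

theorem tendsto_norm_of_tendsto_sub {x a : ℝ → K} {r : ℝ}
    (h : Tendsto (fun s => x s - a s) atTop (𝓝 0)) (ha : ∀ s, 0 < s → ‖a s‖ = r) :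
    Tendsto (fun s => ‖x s‖) atTop (𝓝 r) := by
  have h1 : Tendsto (fun s => ‖x s‖ - r) atTop (𝓝 0) := by
    refine squeeze_zero_norm' ?_ (tendsto_zero_iff_norm_tendsto_zero.1 h)
    filter_upwards [eventually_gt_atTop 0] with s hs
    rw [Real.norm_eq_abs, ← ha s hs]
    exact abs_norm_sub_norm_le _ _
  simpa using h1.add_const r

theorem Outgoing.tendsto_norm_fst (h : Outgoing G δ f₁ f₂ ω ϕ u) :
    Tendsto (fun s => ‖(u s).fst‖) atTop (𝓝 ‖ω.fst‖) :=
  tendsto_norm_of_tendsto_sub h.tendsto_fst fun _ hs => norm_asym1 hs ϕ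

theorem Outgoing.tendsto_norm_snd (h : Outgoing G δ f₁ f₂ ω ϕ u) :
    Tendsto (fun s => ‖(u s).snd‖) atTop (𝓝 ‖ω.snd‖) :=
  tendsto_norm_of_tendsto_sub h.tendsto_snd fun _ hs => norm_asym2 hs ϕ

theorem Outgoing.normSq_eq (h : Outgoing G δ f₁ f₂ ω ϕ u) (hu : IsLZSol G δ f₁ f₂ u) (s : ℝ) :
    ‖u s‖ ^ 2 = ‖ω‖ ^ 2 := by
  have h1 := (h.tendsto_norm_fst.pow 2).add (h.tendsto_norm_snd.pow 2)
  simp_rw [← WithLp.prod_norm_sq_eq_of_L2, fun t => hu.norm_eq t s] at h1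
  exact tendsto_nhds_unique tendsto_const_nhds h1

/-- Two solutions with the same outgoing state coincide. -/
theorem Outgoing.eq [FiniteDimensional ℂ K] (hf₁ : ContDiff ℝ 2 f₁) (hf₂ : ContDiff ℝ 2 f₂)
    (hu : IsLZSol G δ f₁ f₂ u) (hu' : IsLZSol G δ f₁ f₂ u')
    (h : Outgoing G δ f₁ f₂ ω ϕ u) (h' : Outgoing G δ f₁ f₂ ω ϕ u') : u = u' := by
  obtain ⟨Φ, hr⟩ := exists_isLZReg (contDiff_slice hf₁ δ (‖ω‖ ^ 2))
    (contDiff_slice hf₂ δ (‖ω‖ ^ 2)) (normSq_fst_mem ω)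
  obtain ⟨t₀, h1, h2⟩ := IsLZPair.exists_forall_eq hr (isModelPhase_modelPhase G 1 _)
    (isModelPhase_modelPhase (adjoint G) (-1) _) (hu.isLZPair (h.normSq_eq hu))
    (hu'.isLZPair (h'.normSq_eq hu')) (h.tendsto_norm_fst.pow 2) (h'.tendsto_norm_fst.pow 2)
    (by simpa using h.tendsto_fst.sub h'.tendsto_fst)
    (by simpa using h.tendsto_snd.sub h'.tendsto_snd)
  have h0 : u t₀ = u' t₀ := (WithLp.ofLp_injective 2) (Prod.ext h1 h2)
  have hn : ∀ s, ‖u s‖ ≤ ‖ω‖ := fun s =>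
    (pow_le_pow_iff_left₀ (norm_nonneg _) (norm_nonneg _) two_ne_zero).1 (h.normSq_eq hu s).le
  have hn' : ∀ s, ‖u' s‖ ≤ ‖ω‖ := fun s =>
    (pow_le_pow_iff_left₀ (norm_nonneg _) (norm_nonneg _) two_ne_zero).1 (h'.normSq_eq hu' s).le
  funext s
  exact eq_of_hasDerivAt_of_contDiff
    (contDiff_lzField G δ (hf₁.of_le one_le_two) (hf₂.of_le one_le_two))
    (a := min t₀ s - 1) (b := max t₀ s + 1)
    ⟨by linarith [min_le_left t₀ s], by linarith [le_max_left t₀ s]⟩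
    (fun t _ => ⟨hu t, hn t⟩) (fun t _ => ⟨hu' t, hn' t⟩) h0
    ⟨by linarith [min_le_right t₀ s], by linarith [le_max_right t₀ s]⟩

end Asymptotics

section Existence

/-- Solutions defined by prescribed values accumulate at a solution satisfying the same closed
constraints. -/
theorem exists_hasDerivAt_mem_of_seq {E : Type*} [NormedAddCommGroup E] [InnerProductSpace ℂ E]
    [FiniteDimensional ℂ E] {v : ℝ → E → E} (hv : ContDiff ℝ 1 (fun p : ℝ × E => v p.1 p.2))
    (horth : ∀ t x, (⟪x, v t x⟫_ℂ).re = 0) {u : ℕ → ℝ → E} {r : ℝ}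
    (hu : ∀ i t, HasDerivAt (u i) (v t (u i t)) t) (hr : ∀ i t, ‖u i t‖ ≤ r)
    {A : ℝ → Set E} (hA : ∀ t, IsClosed (A t)) {t₀ : ℝ}
    (huA : ∀ t, t₀ ≤ t → ∀ᶠ i in atTop, u i t ∈ A t) :
    ∃ w : ℝ → E, (∀ t, HasDerivAt w (v t (w t)) t) ∧ ∀ t, t₀ ≤ t → w t ∈ A t := by
  have : ProperSpace E := FiniteDimensional.proper ℂ E
  obtain ⟨x, hx, ψ, hψ, hlim⟩ := (isCompact_closedBall (0 : E) r).tendsto_subseq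
    (x := fun i => u i t₀) (fun i => by simpa using hr i t₀)
  obtain ⟨w, hw0, hw⟩ := exists_forall_hasDerivAt_of_orthogonal hv horth t₀ x
  have hwr : ∀ t, ‖w t‖ ≤ r := fun t => by
    rw [norm_eq_of_hasDerivAt_orthogonal isOpen_univ isPreconnected_univ horth
      (fun t _ => hw t) (Set.mem_univ t) (Set.mem_univ t₀), hw0]
    simpa using hx
  refine ⟨w, hw, fun t ht => ?_⟩
  obtain ⟨M, hM⟩ := exists_dist_le_of_hasDerivAt hv t₀ t r
  have h1 : Tendsto (fun j => M * ‖u (ψ j) t₀ - w t₀‖) atTop (𝓝 0) := by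
    rw [hw0]
    simpa using (tendsto_iff_norm_sub_tendsto_zero.1 hlim).const_mul M
  have h2 : Tendsto (fun j => u (ψ j) t) atTop (𝓝 (w t)) :=
    tendsto_iff_norm_sub_tendsto_zero.2 <| squeeze_zero (fun _ => norm_nonneg _)
      (fun j => hM _ _ (hu _) hw (hr _) hwr t ⟨ht, le_rfl⟩) h1
  exact (hA t).mem_of_tendsto h2 (hψ.tendsto_atTop.eventually (huA t ht))

theorem exists_mul_eq_of_sq_eq_add {w W c d : ℝ} (hw : 0 ≤ w) (hW : 0 ≤ W)
    (h : W ^ 2 = w ^ 2 + c) (hc : 0 ≤ c) (hd : 0 ≤ d) (hcd : c ≤ d * w ^ 2) :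
    ∃ l, 0 ≤ l ∧ l * W = w ∧ |l - 1| ≤ d := by
  rcases hw.eq_or_lt with rfl | hw
  · refine ⟨1, zero_le_one, ?_, by simpa using hd⟩
    have : W ^ 2 ≤ 0 := by linarith
    nlinarith
  · have hwW : w ≤ W := by nlinarith
    have hW0 : 0 < W := hw.trans_le hwW
    refine ⟨w / W, by positivity, by field_simp, ?_⟩
    rw [abs_sub_comm, abs_of_nonneg (by rw [sub_nonneg, div_le_one hW0]; exact hwW),
      show 1 - w / W = (W - w) / W by field_simp, div_le_iff₀ hW0]
    have h1 : (W - w) * (W + w) ≤ d * W * (W + w) := by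
      have : d * w ^ 2 ≤ d * (W * (W + w)) := by gcongr; nlinarith
      nlinarith
    exact le_of_mul_le_mul_right h1 (by positivity)

variable {K : Type*} [NormedAddCommGroup K] [InnerProductSpace ℂ K] [CompleteSpace K]
variable {G : K →L[ℂ] K} {δ : ℝ} {f₁ f₂ : ℝ × ℝ → ℝ}

/-- The first-order adiabatic correction of the pair `(a, b)`. -/
def adiabaticPair (G : K →L[ℂ] K) (t : ℝ) (a b : K) : WithLp 2 (K × K) :=
  WithLp.toLp 2 (a - ((1 / (2 * t) : ℝ) : ℂ) • G b, b + ((1 / (2 * t) : ℝ) : ℂ) • adjoint G a)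

theorem normSq_adiabaticPair (G : K →L[ℂ] K) (t : ℝ) (a b : K) :
    ‖adiabaticPair G t a b‖ ^ 2
      = ‖a‖ ^ 2 + ‖b‖ ^ 2 + (‖G b‖ ^ 2 + ‖adjoint G a‖ ^ 2) / (4 * t ^ 2) := by
  have h1 : b + ((1 / (2 * t) : ℝ) : ℂ) • adjoint G a
      = b - ((1 / (2 * (-t)) : ℝ) : ℂ) • adjoint G a := by
    rw [show (1 / (2 * (-t)) : ℝ) = -(1 / (2 * t)) by rw [mul_neg, div_neg]]
    push_cast
    module
  have h2 : (⟪b, adjoint G a⟫_ℂ).re = (⟪a, G b⟫_ℂ).re := by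
    rw [adjoint_inner_right, ← inner_conj_symm, Complex.conj_re]
  have h3 : ‖adiabaticPair G t a b‖ ^ 2 = ‖a - ((1 / (2 * t) : ℝ) : ℂ) • G b‖ ^ 2
      + ‖b + ((1 / (2 * t) : ℝ) : ℂ) • adjoint G a‖ ^ 2 := WithLp.prod_norm_sq_eq_of_L2 _
  rw [h3, h1, normSq_correction, normSq_correction, h2, neg_sq, div_neg]
  ring

theorem exists_normalize_adiabaticPair (G : K →L[ℂ] K) {t : ℝ} (ht : 0 < t) (a b : K) (r : ℝ)
    (hr : 0 ≤ r) (hab : ‖a‖ ^ 2 + ‖b‖ ^ 2 = r ^ 2) :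
    ∃ l : ℝ, ‖(l : ℂ) • adiabaticPair G t a b‖ = r ∧ |l - 1| ≤ ‖G‖ ^ 2 * (1 / t ^ 2) := by
  have h1 : ‖G b‖ ^ 2 ≤ ‖G‖ ^ 2 * ‖b‖ ^ 2 := by
    rw [← mul_pow]; gcongr; exact G.le_opNorm b
  have h2 : ‖adjoint G a‖ ^ 2 ≤ ‖G‖ ^ 2 * ‖a‖ ^ 2 := by
    rw [← mul_pow, ← (adjoint (𝕜 := ℂ) (E := K) (F := K)).norm_map G]
    gcongr
    exact (adjoint G).le_opNorm a
  obtain ⟨l, hl, hl1, hl2⟩ := exists_mul_eq_of_sq_eq_add (d := ‖G‖ ^ 2 * (1 / t ^ 2)) hr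
    (norm_nonneg (adiabaticPair G t a b)) (by rw [normSq_adiabaticPair, hab])
    (by positivity) (by positivity) (by
      rw [← hab, div_le_iff₀ (by positivity)]
      have : ‖G‖ ^ 2 * (1 / t ^ 2) * (‖a‖ ^ 2 + ‖b‖ ^ 2) * (4 * t ^ 2)
          = 4 * (‖G‖ ^ 2 * ‖a‖ ^ 2 + ‖G‖ ^ 2 * ‖b‖ ^ 2) := by field_simp
      rw [this]
      have : 0 ≤ ‖G‖ ^ 2 * ‖a‖ ^ 2 + ‖G‖ ^ 2 * ‖b‖ ^ 2 := by positivity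
      linarith)
  exact ⟨l, by rw [norm_smul, Complex.norm_real, Real.norm_of_nonneg hl, hl1], hl2⟩

/-- Existence of a solution with prescribed outgoing state. -/
theorem exists_isLZSol_norm_sub_asym_le [FiniteDimensional ℂ K] (hf₁ : ContDiff ℝ 2 f₁)
    (hf₂ : ContDiff ℝ 2 f₂) (ω : WithLp 2 (K × K)) :
    ∃ u : ℝ → WithLp 2 (K × K), IsLZSol G δ f₁ f₂ u ∧ ∃ C > 0, ∀ s : ℝ, 1 ≤ s →
      ‖(u s).fst - asym1 G δ f₁ ω 0 s‖ ≤ C / s ∧ ‖(u s).snd - asym2 G δ f₂ ω 0 s‖ ≤ C / s := by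
  obtain ⟨Φ, hr⟩ := exists_isLZReg (contDiff_slice hf₁ δ (‖ω‖ ^ 2))
    (contDiff_slice hf₂ δ (‖ω‖ ^ 2)) (normSq_fst_mem ω)
  have hv := contDiff_lzField G δ (hf₁.of_le one_le_two) (hf₂.of_le one_le_two)
  have horth := re_inner_lzField G δ f₁ f₂
  set a : ℝ → K := asym1 G δ f₁ ω 0 with ha
  set b : ℝ → K := asym2 G δ f₂ ω 0 with hb
  have hab : ∀ t, 0 < t → ‖a t‖ ^ 2 + ‖b t‖ ^ 2 = ‖ω‖ ^ 2 := fun t ht => by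
    rw [WithLp.prod_norm_sq_eq_of_L2, ha, hb, norm_asym1 ht, norm_asym2 ht]
  choose! l hl1 hl2 using fun t (ht : 0 < t) =>
    exists_normalize_adiabaticPair G ht (a t) (b t) ‖ω‖ (norm_nonneg _) (hab t ht)
  have hT : ∀ i : ℕ, (0 : ℝ) < i + 1 := fun i => by positivity
  choose u hu1 hu using fun i : ℕ => exists_forall_hasDerivAt_of_orthogonal hv horth (i + 1 : ℝ)
    ((l (i + 1) : ℂ) • adiabaticPair G (i + 1) (a (i + 1)) (b (i + 1)))
  have hu : ∀ i, IsLZSol G δ f₁ f₂ (u i) := hu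
  have hnorm : ∀ i t, ‖u i t‖ = ‖ω‖ := fun i t => by
    rw [(hu i).norm_eq t (i + 1), hu1, hl1 _ (hT i)]
  set S' : Set (ℕ × ℝ) := {p | p.2 = p.1 + 1}
  set S : Set (ℕ × ℝ) := {p | 1 ≤ p.2 ∧ p.2 ≤ p.1 + 1}
  have hS' : IsDecDomain S' (fun _ => 1) := by
    refine ⟨fun p hp => ?_, fun _ _ => zero_le_one⟩
    have hp : p.2 = p.1 + 1 := hp
    rw [hp]
    simp
  have hS : IsDecDomain S (fun _ => 1) := ⟨fun p hp => hp.1, fun _ _ => zero_le_one⟩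
  have hpair := fun i => (hu i).isLZPair (E := ‖ω‖ ^ 2) fun t => by rw [hnorm]
  have hval : ∀ p ∈ S', u p.1 p.2 = (l p.2 : ℂ) • adiabaticPair G p.2 (a p.2) (b p.2) := by
    intro p hp
    have hp : p.2 = p.1 + 1 := hp
    rw [hp, hu1]
  obtain ⟨h1, h2, h3⟩ := dec_lzEnergy_of_correction hS' hr hpair
    (a := fun p => a p.2) (b := fun p => b p.2) (l := fun p => l p.2) (M := ‖ω.snd‖)
    (fun p hp => by rw [ha]; simp only [norm_asym1 (hS'.pos hp)])
    (fun p hp => (norm_asym2 (hS'.pos hp) 0).le)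
    ⟨‖G‖ ^ 2, by positivity, fun p hp => hl2 _ (hS'.pos hp)⟩
    (fun p hp => congrArg WithLp.fst (hval p hp)) (fun p hp => congrArg WithLp.snd (hval p hp))
  have hV₁ := isModelPhase_modelPhase G 1 (δ * F1 f₁ ω)
  have hV₂ := isModelPhase_modelPhase (adjoint G) (-1) (δ * F2 f₂ ω)
  rw [mul_F1_eq] at hV₁
  rw [mul_F2_eq] at hV₂
  obtain ⟨⟨C₁, hC₁, h4⟩, ⟨C₂, hC₂, h5⟩⟩ := dec_pair_model_sub hS hS' (T := fun i => (i : ℝ) + 1)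
    (fun p hp => ⟨hp.2, fun τ hτ => ⟨hp.1.trans hτ.1, hτ.2⟩, rfl⟩) hr hV₁ hV₂ hpair ω.fst ω.snd
    (h1.of_le 1 fun p hp => by
      rw [← mul_F1_eq, norm_modelPhase_sub_fst (hS'.pos hp), one_mul])
    (h2.of_le 1 fun p hp => by
      rw [← mul_F2_eq, norm_modelPhase_sub_snd (hS'.pos hp), one_mul]) h3
  obtain ⟨w, hw, hwA⟩ := exists_hasDerivAt_mem_of_seq hv horth hu (fun i t => (hnorm i t).le)
    (A := fun s => {z | ‖z.fst - a s‖ ≤ C₁ / s ∧ ‖z.snd - b s‖ ≤ C₂ / s}) (t₀ := 1)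
    (fun s => by
      have hfst : Continuous fun z : WithLp 2 (K × K) => z.fst := (WithLp.fstL 2 ℂ K K).continuous
      have hsnd : Continuous fun z : WithLp 2 (K × K) => z.snd := (WithLp.sndL 2 ℂ K K).continuous
      exact (isClosed_le (hfst.sub continuous_const).norm continuous_const).inter
        (isClosed_le (hsnd.sub continuous_const).norm continuous_const))
    (fun s hs => by
      filter_upwards [eventually_ge_atTop ⌈s⌉₊] with i hi
      have hp : (i, s) ∈ S := ⟨hs, by
        have : s ≤ i := (Nat.le_ceil s).trans (by exact_mod_cast hi)
        show s ≤ (i : ℝ) + 1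
        linarith⟩
      have h6 := h4 _ hp
      have h7 := h5 _ hp
      rw [← mul_F1_eq, norm_modelPhase_sub_fst (hS.pos hp), pow_one, mul_one_div] at h6
      rw [← mul_F2_eq, norm_modelPhase_sub_snd (hS.pos hp), pow_one, mul_one_div] at h7
      exact ⟨h6, h7⟩)
  refine ⟨w, hw, C₁ + C₂ + 1, by positivity, fun s hs => ?_⟩
  have hs0 : 0 < s := zero_lt_one.trans_le hs
  exact ⟨(hwA s hs).1.trans (by gcongr; linarith), (hwA s hs).2.trans (by gcongr; linarith)⟩

end Existence

/-- existence and uniqueness of wave operators (Proposition 1.8). -/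
theorem stmt_3 {K : Type*} [NormedAddCommGroup K] [InnerProductSpace ℂ K]
    [FiniteDimensional ℂ K]
    (G : K →L[ℂ] K) (hG : CommHyp G) (δ : ℝ) (f₁ f₂ : ℝ × ℝ → ℝ)
    (hf₁ : C2Bdd f₁) (hf₂ : C2Bdd f₂) (θ : ℝ → ℝ) (hθ : IsCutoff θ)
    (R : ℝ) (hR : 0 < R) (ω : WithLp 2 (K × K)) (hω : Theta G θ R ω = ω) :
    (∃ ϕ ∈ Set.Ico (0 : ℝ) (2 * Real.pi), ∃ u : ℝ → WithLp 2 (K × K),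
      IsLZSol G δ f₁ f₂ u ∧
      ∃ C > 0, ∀ s : ℝ, 1 ≤ s →
        ‖(u s).fst - asym1 G δ f₁ ω ϕ s‖ ≤ C / s ∧
        ‖(u s).snd - asym2 G δ f₂ ω ϕ s‖ ≤ C / s) ∧
    (∀ ϕ ∈ Set.Ico (0 : ℝ) (2 * Real.pi), ∀ u u' : ℝ → WithLp 2 (K × K),
      IsLZSol G δ f₁ f₂ u → IsLZSol G δ f₁ f₂ u' →
      Outgoing G δ f₁ f₂ ω ϕ u → Outgoing G δ f₁ f₂ ω ϕ u' → u = u') ∧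
    (f₁ = f₂ → ∃ u : ℝ → WithLp 2 (K × K), IsLZSol G δ f₁ f₂ u ∧
      ∃ C > 0, ∀ s : ℝ, 1 ≤ s →
        ‖(u s).fst - asym1 G δ f₁ ω 0 s‖ ≤ C / s ∧
        ‖(u s).snd - asym2 G δ f₂ ω 0 s‖ ≤ C / s) := by
  have : CompleteSpace K := FiniteDimensional.complete ℂ K
  have h2π : 0 < 2 * Real.pi := Real.two_pi_pos
  obtain ⟨u, hu, hC⟩ := exists_isLZSol_norm_sub_asym_le (G := G) (δ := δ) hf₁.1 hf₂.1 ω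
  exact ⟨⟨0, ⟨le_rfl, h2π⟩, u, hu, hC⟩,
    fun ϕ _ u u' hu hu' h h' => Outgoing.eq hf₁.1 hf₂.1 hu hu' h h', fun _ => ⟨u, hu, hC⟩⟩

end
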